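/- arXiv:2108.02135 — 2 statements merged into one kernel-verified Lean document; each statement's English description precedes it below -/
import Mathlib

section
/- Let N ∈ (1,∞) and p ∈ (1,N) be real numbers and set p* := pN/(N−p). Let u : [0,∞) → ℝ be locally absolutely continuous with u(t) → 0 as t → ∞, and let u' denote its almost-everywhere derivative. Then (σ_{N−1} ∫₀^∞ |u(t)|^{p*} t^{N−1} dt)^{1/p*} ≤ Eucl(N,p) · (σ_{N−1} ∫₀^∞ |u'(t)|^{p} t^{N−1} dt)^{1/p}, as an inequality in [0,∞]. -/
open MeasureTheory

/-- The volume of the unit ball in dimension `N` (for real `N > 0`):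
`ω_N = π^{N/2} / Γ(N/2 + 1)`. -/
noncomputable def omegaN (N : ℝ) : ℝ := Real.pi ^ (N / 2) / Real.Gamma (N / 2 + 1)

/-- The sharp Euclidean Sobolev constant `Eucl(N,p)`. -/
noncomputable def Eucl (N p : ℝ) : ℝ :=
  (1 / N) * (N * (p - 1) / (N - p)) ^ ((p - 1) / p) *
    (Real.Gamma (N + 1) /
      (N * omegaN N * Real.Gamma (N / p) * Real.Gamma (N + 1 - N / p))) ^ (1 / N)


namespace Bliss

open Set Filter Topology

/-- target density -/
noncomputable def rho (N q s : ℝ) : ℝ := |s| ^ (N - 1) * (1 + |s| ^ q) ^ (-N)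

noncomputable def GG (N q S : ℝ) : ℝ := ∫ s in (0:ℝ)..S, rho N q s

noncomputable def JJ (N q S : ℝ) : ℝ := ∫ s in (0:ℝ)..S, rho N q s * |s| ^ q

lemma one_add_pos (q s : ℝ) : 0 < 1 + |s| ^ q := by positivity

lemma rho_nonneg (N q s : ℝ) : 0 ≤ rho N q s := by unfold rho; positivity

lemma rho_pos (N q : ℝ) {s : ℝ} (hs : 0 < s) : 0 < rho N q s := by
  have : 0 < |s| := abs_pos.2 hs.ne'
  unfold rho; positivity

lemma rho_cont {N q : ℝ} (hN : 1 < N) (hq : 1 < q) : Continuous (rho N q) := by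
  unfold rho
  refine Continuous.mul ?_ ?_
  · exact continuous_abs.rpow_const (fun x => Or.inr (by linarith))
  · refine Continuous.rpow_const ?_ (fun x => Or.inl (one_add_pos q x).ne')
    exact continuous_const.add (continuous_abs.rpow_const (fun x => Or.inr (by linarith)))

lemma rhoq_cont {N q : ℝ} (hN : 1 < N) (hq : 1 < q) :
    Continuous (fun s => rho N q s * |s| ^ q) :=
  (rho_cont hN hq).mul (continuous_abs.rpow_const (fun x => Or.inr (by linarith)))

lemma GG_strictDeriv {N q : ℝ} (hN : 1 < N) (hq : 1 < q) (s : ℝ) :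
    HasStrictDerivAt (GG N q) (rho N q s) s :=
  (rho_cont hN hq).integral_hasStrictDerivAt 0 s

lemma JJ_deriv {N q : ℝ} (hN : 1 < N) (hq : 1 < q) (s : ℝ) :
    HasDerivAt (JJ N q) (rho N q s * |s| ^ q) s :=
  ((rhoq_cont hN hq).integral_hasStrictDerivAt 0 s).hasDerivAt

lemma GG_zero (N q : ℝ) : GG N q 0 = 0 := by simp [GG]
lemma JJ_zero (N q : ℝ) : JJ N q 0 = 0 := by simp [JJ]

lemma GG_odd (N q S : ℝ) : GG N q (-S) = - GG N q S := by
  unfold GG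
  have h : ∀ s, rho N q (-s) = rho N q s := fun s => by simp [rho]
  have := intervalIntegral.integral_comp_neg (a := 0) (b := S) (rho N q)
  rw [intervalIntegral.integral_symm, neg_inj]
  simp only [h, neg_zero] at this
  exact this.symm

lemma GG_strictMono {N q : ℝ} (hN : 1 < N) (hq : 1 < q) : StrictMono (GG N q) := by
  apply strictMono_of_odd_strictMonoOn_nonneg (GG_odd N q)
  apply strictMonoOn_of_deriv_pos (convex_Ici 0)
  · exact fun x _ => (GG_strictDeriv hN hq x).hasDerivAt.continuousAt.continuousWithinAt
  · intro x hx
    rw [interior_Ici] at hx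
    rw [(GG_strictDeriv hN hq x).hasDerivAt.deriv]
    exact rho_pos N q hx

lemma GG_cont {N q : ℝ} (hN : 1 < N) (hq : 1 < q) : Continuous (GG N q) :=
  continuous_iff_continuousAt.2 fun x => (GG_strictDeriv hN hq x).hasDerivAt.continuousAt

lemma JJ_cont {N q : ℝ} (hN : 1 < N) (hq : 1 < q) : Continuous (JJ N q) :=
  continuous_iff_continuousAt.2 fun x => (JJ_deriv hN hq x).continuousAt

lemma GG_pos {N q : ℝ} (hN : 1 < N) (hq : 1 < q) {S : ℝ} (hS : 0 < S) : 0 < GG N q S := by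
  have := GG_strictMono hN hq hS
  rwa [GG_zero] at this

lemma GG_embed {N q : ℝ} (hN : 1 < N) (hq : 1 < q) : IsEmbedding (GG N q) := by
  refine (GG_strictMono hN hq).isEmbedding_of_ordConnected ?_
  exact (isPreconnected_range (GG_cont hN hq)).ordConnected

lemma JJ_nonneg {N q : ℝ} {S : ℝ} (hS : 0 ≤ S) : 0 ≤ JJ N q S := by
  apply intervalIntegral.integral_nonneg hS
  intro s _
  have := rho_nonneg N q s
  positivity

/-- Integration by parts identity for the target. -/
lemma JJ_ident {N q : ℝ} (hN : 1 < N) (hq : 1 < q) {S : ℝ} (hS : 0 ≤ S) :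
    N * (GG N q S + JJ N q S) - (N - 1) * q * JJ N q S = S ^ N * (1 + S ^ q) ^ (1 - N) := by
  have h1 : ∫ s in (0:ℝ)..S, (N * (rho N q s + rho N q s * |s| ^ q)
      - (N - 1) * q * (rho N q s * |s| ^ q)) = S ^ N * (1 + S ^ q) ^ (1 - N)
        - (0:ℝ) ^ N * (1 + (0:ℝ) ^ q) ^ (1 - N) := by
    apply intervalIntegral.integral_eq_sub_of_hasDerivAt_of_le hS
      (f := fun s => s ^ N * (1 + s ^ q) ^ (1 - N))
    · refine ContinuousOn.mul ?_ ?_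
      · exact continuousOn_id.rpow_const (fun x _ => Or.inr (by linarith))
      · refine ContinuousOn.rpow_const ?_ (fun x hx => Or.inl ?_)
        · exact continuousOn_const.add
            (continuousOn_id.rpow_const (fun x _ => Or.inr (by linarith)))
        · have := Real.rpow_nonneg hx.1 q
          positivity
    · intro s hs
      have hs0 : 0 < s := hs.1
      have hpos : 0 < 1 + s ^ q := by positivity
      have d1 := Real.hasDerivAt_rpow_const (x := s) (p := N) (Or.inl hs0.ne')
      have d2 := ((Real.hasDerivAt_rpow_const (x := s) (p := q)
        (Or.inl hs0.ne')).const_add 1).rpow_const (p := 1 - N) (Or.inl hpos.ne')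
      refine (d1.mul d2).congr_deriv ?_
      simp only [rho, abs_of_pos hs0]
      have e1 : s ^ N = s ^ (N - 1) * s := by
        rw [← Real.rpow_add_one hs0.ne']; ring_nf
      have e2 : s ^ q = s ^ (q - 1) * s := by
        rw [← Real.rpow_add_one hs0.ne']; ring_nf
      have e3 : (1 + s ^ q) ^ (1 - N) = (1 + s ^ q) ^ (-N) * (1 + s ^ q) := by
        rw [← Real.rpow_add_one hpos.ne']; ring_nf
      have e4 : (1 - N - 1) = -N := by ring
      rw [e4, e3, e1]
      generalize (1 + s ^ q) ^ (-N) = Y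
      rw [e2]
      ring
    · apply Continuous.intervalIntegrable
      have := rho_cont hN hq
      have := rhoq_cont hN hq
      fun_prop
  rw [Real.zero_rpow (by linarith), zero_mul, sub_zero] at h1
  rw [← h1, intervalIntegral.integral_sub, intervalIntegral.integral_const_mul,
    intervalIntegral.integral_const_mul, intervalIntegral.integral_add]
  · rfl
  all_goals
    apply Continuous.intervalIntegrable
    have := rho_cont hN hq
    have := rhoq_cont hN hq
    fun_prop

lemma bdry_tendsto {N q : ℝ} (hN : 1 < N) (hNq : N < (N - 1) * q) :
    Tendsto (fun S : ℝ => S ^ N * (1 + S ^ q) ^ (1 - N)) atTop (𝓝 0) := by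
  have h1 : Tendsto (fun S : ℝ => S ^ (-((N - 1) * q - N))) atTop (𝓝 0) :=
    tendsto_rpow_neg_atTop (by linarith)
  refine squeeze_zero' ?_ ?_ h1
  · filter_upwards [eventually_gt_atTop 0] with S hS
    positivity
  · filter_upwards [eventually_gt_atTop 0] with S hS
    have : (1 + S ^ q) ^ (1 - N) ≤ (S ^ q) ^ (1 - N) :=
      Real.rpow_le_rpow_of_nonpos (by positivity) (by linarith) (by linarith)
    calc S ^ N * (1 + S ^ q) ^ (1 - N) ≤ S ^ N * (S ^ q) ^ (1 - N) := by gcongr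
      _ = _ := by
        rw [← Real.rpow_mul hS.le, ← Real.rpow_add hS]; ring_nf

/-- The total mass of the target. -/
lemma lint_rho {N q a b : ℝ} (hq : 1 < q) (ha : 0 < a) (hb : 0 < b) (hab : a + b = N)
    (haq : q * a = N) :
    ∫⁻ s in Ioi (0:ℝ), ENNReal.ofReal (rho N q s) =
      ENNReal.ofReal (ProbabilityTheory.beta a b / q) := by
  have hB := ProbabilityTheory.beta_pos ha hb
  set X : ℝ → ℝ := fun s => 1 - (1 + s ^ q)⁻¹ with hX
  have himg : X '' Ioi 0 = Ioo 0 1 := by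
    ext y; constructor
    · rintro ⟨s, hs, rfl⟩
      have hs : 0 < s := hs
      have : 0 < s ^ q := by positivity
      have h2 : (1 + s ^ q)⁻¹ < 1 := inv_lt_one_of_one_lt₀ (by linarith)
      have h3 : 0 < (1 + s ^ q)⁻¹ := by positivity
      constructor <;> simp only [hX] <;> linarith
    · rintro ⟨h0, h1⟩
      have h2 : 0 < 1 - y := by linarith
      refine ⟨(y / (1 - y)) ^ q⁻¹, ?_, ?_⟩
      · have : 0 < y / (1 - y) := by positivity
        exact Real.rpow_pos_of_pos this _
      · simp only [hX]
        rw [← Real.rpow_mul (by positivity), inv_mul_cancel₀ (by linarith), Real.rpow_one]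
        field_simp
        ring
  have hder : ∀ s ∈ Ioi (0:ℝ), HasDerivAt X (q * s ^ (q - 1) * ((1 + s ^ q) ^ 2)⁻¹) s := by
    intro s hs
    have hs : 0 < s := hs
    have hpos : 0 < 1 + s ^ q := by positivity
    have d2 := (((Real.hasDerivAt_rpow_const (x := s) (p := q)
        (Or.inl hs.ne')).const_add 1).inv hpos.ne').const_sub 1
    refine d2.congr_deriv ?_
    field_simp
  have hinj : InjOn X (Ioi 0) := by
    intro s hs t ht h
    have h' : s ^ q = t ^ q := by
      simp only [hX] at h
      have : (1 + s ^ q)⁻¹ = (1 + t ^ q)⁻¹ := by linarith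
      have := inv_inj.1 this
      linarith
    exact (Real.rpow_left_inj (le_of_lt hs) (le_of_lt ht) (by linarith)).1 h'
  have key := lintegral_image_eq_lintegral_abs_deriv_mul measurableSet_Ioi
    (fun x hx => (hder x hx).hasDerivWithinAt) hinj
    (fun x => ENNReal.ofReal ((1 / ProbabilityTheory.beta a b) * x ^ (a - 1) * (1 - x) ^ (b - 1)))
  rw [himg, ← ProbabilityTheory.lintegral_betaPDF,
    ProbabilityTheory.lintegral_betaPDF_eq_one ha hb] at key
  have key2 : ∫⁻ s in Ioi (0:ℝ), ENNReal.ofReal (rho N q s) =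
      ∫⁻ s in Ioi (0:ℝ), ENNReal.ofReal (ProbabilityTheory.beta a b / q) *
        (ENNReal.ofReal |q * s ^ (q - 1) * ((1 + s ^ q) ^ 2)⁻¹| *
        ENNReal.ofReal ((1 / ProbabilityTheory.beta a b) * X s ^ (a - 1) *
          (1 - X s) ^ (b - 1))) := by
    refine setLIntegral_congr_fun measurableSet_Ioi ?_
    intro s hs
    have hs : 0 < s := hs
    have hpos : 0 < 1 + s ^ q := by positivity
    simp only []
    rw [← ENNReal.ofReal_mul (by positivity), ← ENNReal.ofReal_mul (by positivity),
      abs_of_pos (by positivity)]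
    congr 1
    have e1 : X s = s ^ q * (1 + s ^ q)⁻¹ := by
      simp only [hX]; field_simp; ring
    have e2 : 1 - X s = (1 + s ^ q)⁻¹ := by simp only [hX]; ring
    rw [e2, e1, Real.mul_rpow (by positivity) (by positivity), Real.inv_rpow hpos.le,
      Real.inv_rpow hpos.le, ← Real.rpow_neg hpos.le, ← Real.rpow_neg hpos.le,
      ← Real.rpow_natCast, ← Real.rpow_neg hpos.le, ← Real.rpow_mul hs.le]
    have e3 : rho N q s = (s ^ (q - 1) * s ^ (q * (a - 1))) *
      ((1 + s ^ q) ^ (-((2:ℕ):ℝ)) * (1 + s ^ q) ^ (-(a-1)) * (1 + s ^ q) ^ (-(b-1))) := by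
      rw [← Real.rpow_add hs, ← Real.rpow_add hpos, ← Real.rpow_add hpos, rho, abs_of_pos hs]
      congr 2
      · linarith
      · push_cast; linarith
    rw [e3]
    field_simp
  rw [key2, lintegral_const_mul' _ _ ENNReal.ofReal_ne_top, ← key, mul_one]

lemma GG_tendsto {N q a b : ℝ} (hN : 1 < N) (hq : 1 < q) (ha : 0 < a) (hb : 0 < b)
    (hab : a + b = N) (haq : q * a = N) :
    Tendsto (GG N q) atTop (𝓝 (ProbabilityTheory.beta a b / q)) := by
  have hB := ProbabilityTheory.beta_pos ha hb
  have h := lint_rho hq ha hb hab haq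
  have hm : AEStronglyMeasurable (rho N q) (volume.restrict (Ioi 0)) :=
    (rho_cont hN hq).aestronglyMeasurable
  have hint : IntegrableOn (rho N q) (Ioi 0) := by
    refine ⟨hm, ?_⟩
    rw [hasFiniteIntegral_iff_ofReal (ae_of_all _ (rho_nonneg N q)), h]
    exact ENNReal.ofReal_lt_top
  have h2 : ∫ s in Ioi (0:ℝ), rho N q s = ProbabilityTheory.beta a b / q := by
    rw [integral_eq_lintegral_of_nonneg_ae (ae_of_all _ (rho_nonneg N q)) hm, h,
      ENNReal.toReal_ofReal (by positivity)]
  rw [← h2]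
  exact intervalIntegral_tendsto_integral_Ioi 0 hint tendsto_id

end Bliss

namespace Bliss

open Set Filter Topology

lemma amgm {N q P α m t τ v : ℝ} (hN : 1 < N) (hP : 0 < P)
    (hα : 0 < α) (hαP : α + P / N = P) (hm : 0 < m) (ht : 0 < t) (hτ : 0 < τ) (hv : 0 ≤ v) :
    N * m ^ (1 - 1 / N) * ((rho N q τ + rho N q τ * |τ| ^ q) *
        (v ^ P * t ^ (N - 1) / (m * rho N q τ))) ≤
      v ^ α * (v ^ P * t ^ (N - 1) / (m * rho N q τ) * t ^ (N - 1)
        + τ * ((N - 1) * t ^ (N - 1 - 1))) := by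
  have hρ := rho_pos N q hτ
  set D := v ^ P * t ^ (N - 1) / (m * rho N q τ) with hD
  have hvP : 0 ≤ v ^ P := Real.rpow_nonneg hv _
  have hvα : 0 ≤ v ^ α := Real.rpow_nonneg hv _
  have hD0 : 0 ≤ D := by positivity
  have hmD : m * rho N q τ * D = v ^ P * t ^ (N - 1) := by rw [hD]; field_simp
  have hN0 : 0 < N := by linarith
  have hY : 0 < 1 + τ ^ q := by positivity
  have hw : 0 ≤ 1 - 1 / N := by
    rw [sub_nonneg, div_le_one hN0]; exact hN.le
  have am := Real.geom_mean_le_arith_mean2_weighted (w₁ := 1 / N) (w₂ := 1 - 1 / N)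
    (p₁ := D) (p₂ := τ / t) (by positivity) hw hD0 (by positivity) (by ring)
  have e1 : D ^ (1 / N) * (τ / t) ^ (1 - 1 / N) = v ^ (P / N) * (1 + τ ^ q) * m ^ (-(1 / N)) := by
    have h1 : (τ / t) ^ (1 - 1 / N) = ((τ / t) ^ (N - 1)) ^ (1 / N) := by
      rw [← Real.rpow_mul (by positivity)]; congr 1; field_simp
    have h2 : D * (τ / t) ^ (N - 1) = v ^ P * (1 + τ ^ q) ^ N * m⁻¹ := by
      rw [hD, Real.div_rpow hτ.le ht.le, rho, abs_of_pos hτ, Real.rpow_neg hY.le]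
      field_simp
    rw [h1, ← Real.mul_rpow hD0 (by positivity), h2, Real.mul_rpow (by positivity) (by positivity),
      Real.mul_rpow (by positivity) (by positivity), ← Real.rpow_mul hv,
      ← Real.rpow_mul hY.le, Real.inv_rpow hm.le, ← Real.rpow_neg hm.le]
    rw [mul_one_div, mul_one_div, div_self hN0.ne', Real.rpow_one]
  rw [e1] at am
  have e2 : m ^ (1 - 1 / N) = m * m ^ (-(1 / N)) := by
    rw [sub_eq_add_neg, Real.rpow_add hm, Real.rpow_one]
  have e3 : v ^ P = v ^ α * v ^ (P / N) := by
    rw [← Real.rpow_add_of_nonneg hv hα.le (by positivity), hαP]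
  have e4 : t ^ (N - 1) = t ^ (N - 1 - 1) * t := by
    rw [← Real.rpow_add_one ht.ne']; ring_nf
  rw [e2, abs_of_pos hτ]
  calc N * (m * m ^ (-(1 / N))) * ((rho N q τ + rho N q τ * τ ^ q) * D)
      = N * m ^ (-(1 / N)) * (1 + τ ^ q) * (m * rho N q τ * D) := by ring
    _ = (N * v ^ α * t ^ (N - 1)) * (v ^ (P / N) * (1 + τ ^ q) * m ^ (-(1 / N))) := by
        rw [hmD, e3]; ring
    _ ≤ (N * v ^ α * t ^ (N - 1)) * (1 / N * D + (1 - 1 / N) * (τ / t)) := by gcongr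
    _ = v ^ α * (D * t ^ (N - 1) + τ * ((N - 1) * (t ^ (N - 1) / t))) := by field_simp
    _ = _ := by rw [e4]; field_simp

lemma ac_of_dist {f g : ℝ → ℝ} {a b C : ℝ} (hg : AbsolutelyContinuousOnInterval g a b)
    (h : ∀ x ∈ uIcc a b, ∀ y ∈ uIcc a b, dist (f x) (f y) ≤ C * dist (g x) (g y)) :
    AbsolutelyContinuousOnInterval f a b := by
  unfold AbsolutelyContinuousOnInterval at hg ⊢
  have := hg.const_mul C
  rw [mul_zero] at this
  refine squeeze_zero' (Eventually.of_forall fun E => Finset.sum_nonneg fun _ _ => dist_nonneg)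
    ?_ this
  have hmem : AbsolutelyContinuousOnInterval.disjWithin a b ∈
    AbsolutelyContinuousOnInterval.totalLengthFilter (X := ℝ) ⊓
      𝓟 (AbsolutelyContinuousOnInterval.disjWithin a b) := mem_inf_of_right (mem_principal_self _)
  filter_upwards [hmem] with E hE
  rw [Finset.mul_sum]
  exact Finset.sum_le_sum fun i hi => h _ (hE.1 i hi).1 _ (hE.1 i hi).2

lemma ac_rpow {v : ℝ → ℝ} {a b α : ℝ} (hα : 1 ≤ α) (hv : AbsolutelyContinuousOnInterval v a b) :
    AbsolutelyContinuousOnInterval (fun t => v t ^ α) a b := by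
  obtain ⟨B, hB⟩ := hv.exists_bound
  have hlip : ∃ K, LipschitzOnWith K (fun x : ℝ => x ^ α) (Icc (-B) B) := by
    have : ContDiffOn ℝ 1 (fun x : ℝ => x ^ α) (Icc (-B) B) :=
      (Real.contDiff_rpow_const_of_le (n := 1) (by simpa using hα)).contDiffOn
    exact this.exists_lipschitzOnWith (by decide) (convex_Icc _ _) isCompact_Icc
  obtain ⟨K, hK⟩ := hlip
  refine ac_of_dist (C := K) hv ?_
  intro x hx y hy
  exact hK.dist_le_mul _ (abs_le.1 (hB x hx)) _ (abs_le.1 (hB y hy))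

/-- Existence of the monotone transport. -/
lemma exists_transport {N q R S m : ℝ} (hN : 1 < N) (hq : 1 < q) (hR : 0 < R) (hS : 0 < S)
    {f : ℝ → ℝ} (hf : Continuous f) (hf0 : ∀ t, 0 ≤ f t) (hm : 0 < m)
    (hMpos : ∀ t ∈ Ioc 0 R, 0 < ∫ s in (0:ℝ)..t, f s)
    (hMm : (∫ s in (0:ℝ)..R, f s) = m * GG N q S) :
    ∃ T : ℝ → ℝ, T 0 = 0 ∧ T R = S ∧ ContinuousOn T (Icc 0 R) ∧
      (∀ t ∈ Ioo 0 R, 0 < T t) ∧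
      ∀ t ∈ Ioo 0 R, HasDerivAt T (f t / (m * rho N q (T t))) t := by
  set M : ℝ → ℝ := fun t => ∫ s in (0:ℝ)..t, f s with hM
  have hMd : ∀ t, HasDerivAt M (f t) t := fun t => (hf.integral_hasStrictDerivAt 0 t).hasDerivAt
  have hMc : Continuous M := continuous_iff_continuousAt.2 fun t => (hMd t).continuousAt
  have hMmono : Monotone M := monotone_of_deriv_nonneg (fun t => (hMd t).differentiableAt)
    (fun t => by rw [(hMd t).deriv]; exact hf0 t)
  have hM0 : M 0 = 0 := by simp [hM]
  have hMR : M R = m * GG N q S := hMm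
  have hex : ∀ t, ∃ s, t ∈ Icc 0 R → s ∈ Icc 0 S ∧ GG N q s = M t / m := by
    intro t
    by_cases ht : t ∈ Icc 0 R
    · have h1 : M t / m ∈ Icc (GG N q 0) (GG N q S) := by
        rw [GG_zero]
        constructor
        · have := hMmono ht.1
          rw [hM0] at this
          positivity
        · rw [div_le_iff₀ hm, mul_comm, ← hMR]
          exact hMmono ht.2
      obtain ⟨s, hs, h⟩ := intermediate_value_Icc hS.le (GG_cont hN hq).continuousOn h1
      exact ⟨s, fun _ => ⟨hs, h⟩⟩
    · exact ⟨0, fun h => absurd h ht⟩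
  choose T hT using hex
  have hTc : ContinuousOn T (Icc 0 R) := by
    rw [(GG_embed hN hq).continuousOn_iff]
    refine (hMc.div_const m).continuousOn.congr ?_
    intro t ht
    exact (hT t ht).2
  have hTpos : ∀ t ∈ Ioo 0 R, 0 < T t := by
    intro t ht
    have h := (hT t (Ioo_subset_Icc_self ht)).2
    have h2 : 0 < M t / m := div_pos (hMpos t ⟨ht.1, ht.2.le⟩) hm
    rw [← h, ← GG_zero N q] at h2
    exact (GG_strictMono hN hq).lt_iff_lt.1 h2
  refine ⟨T, ?_, ?_, hTc, hTpos, ?_⟩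
  · apply (GG_strictMono hN hq).injective
    rw [(hT 0 ⟨le_rfl, hR.le⟩).2, hM0, GG_zero, zero_div]
  · apply (GG_strictMono hN hq).injective
    rw [(hT R ⟨hR.le, le_rfl⟩).2, hMR]
    field_simp
  · intro t ht
    have hρ := rho_pos N q (hTpos t ht)
    have hnb : Icc 0 R ∈ 𝓝 t := Icc_mem_nhds ht.1 ht.2
    have hTct : ContinuousAt T t := hTc.continuousAt hnb
    have hsd := GG_strictDeriv hN hq (T t)
    have hleft := (hsd.hasStrictFDerivAt_equiv hρ.ne').eventually_left_inverse
    have hgd := (hsd.to_localInverse hρ.ne').hasDerivAt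
    set g := hsd.localInverse (GG N q) (rho N q (T t)) (T t) hρ.ne' with hg
    have hGT : GG N q (T t) = M t / m := (hT t (Ioo_subset_Icc_self ht)).2
    rw [hGT] at hgd
    have hcomp := HasDerivAt.comp t hgd ((hMd t).div_const m)
    have heq : T =ᶠ[𝓝 t] g ∘ fun t => M t / m := by
      filter_upwards [hTct.eventually hleft, hnb] with s hs1 hs2
      rw [Function.comp, ← (hT s hs2).2]
      exact hs1.symm
    refine (hcomp.congr_of_eventuallyEq heq).congr_deriv ?_
    field_simp

end Bliss

namespace Bliss

open Set Filter Topology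

lemma core {N p q P α R S : ℝ} (hN : 1 < N) (hpq : p.HolderConjugate q) (hα : 1 < α)
    (hP : 0 < P) (hαP : α + P / N = P) (hαq : (α - 1) * q = P) (hR : 0 < R) (hS : 0 < S)
    {w : ℝ → ℝ} (hw0 : ∀ t, 0 ≤ w t) (hwi : Integrable w)
    (hwp : IntervalIntegrable (fun t => w t ^ p * t ^ (N - 1)) volume 0 R)
    {m : ℝ} (hm : 0 < m)
    (hMm : (∫ t in (0:ℝ)..R, |∫ s in t..R, w s| ^ P * |t| ^ (N - 1)) = m * GG N q S) :
    N * m ^ (1 - 1 / N) * (GG N q S + JJ N q S) ≤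
      α * ((∫ t in (0:ℝ)..R, w t ^ p * t ^ (N - 1)) ^ (1 / p) * (m * JJ N q S) ^ (1 / q)) := by
  have hp1 : 1 < p := hpq.lt
  have hq1 : 1 < q := hpq.symm.lt
  have hN0 : 0 < N := by linarith
  have hwii : ∀ a b, IntervalIntegrable w volume a b := fun a b => hwi.intervalIntegrable
  set v : ℝ → ℝ := fun t => ∫ s in t..R, w s with hv
  have hvR : v R = 0 := by simp [hv]
  have hveq : v = fun t => - ∫ s in R..t, w s := by
    funext t; simp only [hv]; rw [intervalIntegral.integral_symm]
  have hvc : Continuous v := by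
    rw [hveq]; exact (intervalIntegral.continuous_primitive hwii R).neg
  have hvanti : ∀ s t, s ≤ t → v t ≤ v s := by
    intro s t hst
    have h1 : v s = (∫ x in s..t, w x) + v t :=
      (intervalIntegral.integral_add_adjacent_intervals (hwii _ _) (hwii _ _)).symm
    have := intervalIntegral.integral_nonneg (μ := volume) hst (fun x _ => hw0 x)
    linarith
  have hv0 : ∀ t ∈ Icc 0 R, 0 ≤ v t := by
    intro t ht; rw [← hvR]; exact hvanti t R ht.2
  set f : ℝ → ℝ := fun t => |v t| ^ P * |t| ^ (N - 1) with hf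
  have hfc : Continuous f :=
    (hvc.abs.rpow_const fun _ => Or.inr hP.le).mul
      (continuous_abs.rpow_const fun _ => Or.inr (by linarith))
  have hf0 : ∀ t, 0 ≤ f t := fun t => by positivity
  have hfeq : ∀ t ∈ Icc 0 R, f t = v t ^ P * t ^ (N - 1) := by
    intro t ht
    simp only [hf]; rw [abs_of_nonneg (hv0 t ht), abs_of_nonneg ht.1]
  have hMm' : (∫ t in (0:ℝ)..R, f t) = m * GG N q S := hMm
  have hMRpos : 0 < ∫ t in (0:ℝ)..R, f t := by
    rw [hMm']; exact mul_pos hm (GG_pos hN hq1 hS)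
  have hv00 : 0 < v 0 := by
    rcases (hv0 0 ⟨le_rfl, hR.le⟩).lt_or_eq with h | h
    · exact h
    · exfalso
      have : (∫ t in (0:ℝ)..R, f t) = ∫ t in (0:ℝ)..R, (0:ℝ) := by
        apply intervalIntegral.integral_congr
        intro t ht
        rw [uIcc_of_le hR.le] at ht
        have : v t = 0 := le_antisymm (by rw [h]; exact hvanti 0 t ht.1) (hv0 t ht)
        simp only [hf, this, abs_zero, Real.zero_rpow hP.ne', zero_mul]
      rw [this] at hMRpos
      simp at hMRpos
  have hMpos : ∀ t ∈ Ioc 0 R, 0 < ∫ s in (0:ℝ)..t, f s := by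
    intro t ht
    have hev : ∀ᶠ s in 𝓝 (0:ℝ), 0 < v s := hvc.continuousAt.eventually (lt_mem_nhds hv00)
    obtain ⟨δ, hδ, hδv⟩ := Metric.eventually_nhds_iff.1 hev
    set d := min (δ / 2) t with hd
    have hd0 : 0 < d := lt_min (by linarith) ht.1
    have h1 : 0 < ∫ s in (0:ℝ)..d, f s := by
      apply intervalIntegral.intervalIntegral_pos_of_pos_on (hfc.intervalIntegrable _ _) _ hd0
      intro s hs
      have hs0 : 0 < s := hs.1
      have : 0 < v s := by
        apply hδv
        rw [Real.dist_eq, sub_zero, abs_of_pos hs0]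
        have := hs.2
        have := min_le_left (δ / 2) t
        linarith
      have h2 : 0 < |v s| := abs_pos.2 this.ne'
      have h3 : 0 < |s| := abs_pos.2 hs0.ne'
      simp only [hf]; positivity
    have h2 : 0 ≤ ∫ s in d..t, f s :=
      intervalIntegral.integral_nonneg (min_le_right _ _) fun s _ => hf0 s
    rw [← intervalIntegral.integral_add_adjacent_intervals (hfc.intervalIntegrable 0 d)
      (hfc.intervalIntegrable d t)]
    linarith
  obtain ⟨T, hT0, hTR, hTc, hTpos, hTd⟩ :=
    exists_transport hN hq1 hR hS hfc hf0 hm hMpos hMm'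
  have hTnn : ∀ t ∈ Icc 0 R, 0 ≤ T t := by
    intro t ht
    rcases eq_or_lt_of_le ht.1 with h | h
    · rw [← h, hT0]
    rcases eq_or_lt_of_le ht.2 with h' | h'
    · rw [h', hTR]; exact hS.le
    exact (hTpos t ⟨h, h'⟩).le
  have huIcc : uIcc 0 R = Icc 0 R := uIcc_of_le hR.le
  have hmin : Ioo (min 0 R) (max 0 R) = Ioo 0 R := by rw [min_eq_left hR.le, max_eq_right hR.le]
  have htN : Continuous fun t : ℝ => t ^ (N - 1) :=
    continuous_id.rpow_const fun _ => Or.inr (by linarith)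
  -- the weight K
  set K : ℝ → ℝ := fun t => T t * t ^ (N - 1) with hK
  set D : ℝ → ℝ := fun t => f t / (m * rho N q (T t)) with hD
  set K' : ℝ → ℝ := fun t => D t * t ^ (N - 1) + T t * ((N - 1) * t ^ (N - 1 - 1)) with hK'
  have hD0 : ∀ t, 0 ≤ D t := fun t => by
    have := rho_nonneg N q (T t)
    have := hf0 t
    positivity
  have hKc : ContinuousOn K (Icc 0 R) := hTc.mul htN.continuousOn
  have hKd : ∀ t ∈ Ioo 0 R, HasDerivAt K (K' t) t := fun t ht =>
    (hTd t ht).mul (Real.hasDerivAt_rpow_const (Or.inl ht.1.ne'))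
  have hK'0 : ∀ t ∈ Ioo 0 R, 0 ≤ K' t := by
    intro t ht
    have h1 := hD0 t
    have h2 := (hTpos t ht).le
    have h3 : 0 ≤ N - 1 := by linarith
    have h4 : 0 < t := ht.1
    simp only [hK']; positivity
  have hK'i : IntervalIntegrable K' volume 0 R :=
    intervalIntegral.intervalIntegrable_deriv_of_nonneg (huIcc ▸ hKc) (hmin ▸ hKd) (hmin ▸ hK'0)
  have hKint : ∀ t ∈ Icc 0 R, K t = ∫ s in (0:ℝ)..t, K' s := by
    intro t ht
    rw [intervalIntegral.integral_eq_sub_of_hasDerivAt_of_le ht.1 (f := K)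
      (hKc.mono (Icc_subset_Icc_right ht.2)) (fun s hs => hKd s ⟨hs.1, hs.2.trans_le ht.2⟩)
      (hK'i.mono_set (by rw [huIcc, uIcc_of_le ht.1]; exact Icc_subset_Icc_right ht.2))]
    simp [hK, hT0]
  have hKac : AbsolutelyContinuousOnInterval K 0 R := by
    refine ac_of_dist (C := 1)
      (hK'i.absolutelyContinuousOnInterval_intervalIntegral (c := 0) (by simp)) ?_
    intro x hx y hy
    rw [huIcc] at hx hy
    rw [hKint x hx, hKint y hy, one_mul]
  have hvac : AbsolutelyContinuousOnInterval v 0 R := by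
    rw [hveq]
    exact ((hwii 0 R).absolutelyContinuousOnInterval_intervalIntegral (c := R) (by simp)).fun_neg
  have hvαac := ac_rpow hα.le hvac
  have hvαd : ∀ᵐ t, t ∈ uIcc 0 R → deriv (fun t => v t ^ α) t = - (α * v t ^ (α - 1) * w t) := by
    filter_upwards [(hwii 0 R).ae_hasDerivAt_integral] with t ht htm
    have h1 : HasDerivAt v (- w t) t := by
      rw [hveq]; exact (ht htm R (by simp)).neg
    rw [(h1.rpow_const (p := α) (Or.inr hα.le)).deriv]
    ring
  have hibp := hvαac.integral_mul_deriv_eq_deriv_mul hKac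
  have hK0 : K 0 = 0 := by simp [hK, hT0]
  simp only [hvR, hK0] at hibp
  rw [Real.zero_rpow (by linarith), zero_mul, mul_zero, sub_zero, zero_sub,
    ← intervalIntegral.integral_neg] at hibp
  have hibp2 : ∫ t in (0:ℝ)..R, v t ^ α * K' t =
      ∫ t in (0:ℝ)..R, α * ((w t * t ^ ((N - 1) / p)) * (v t ^ (α - 1) * T t * t ^ ((N - 1) / q))) := by
    have h1 : ∫ t in (0:ℝ)..R, v t ^ α * K' t = ∫ t in (0:ℝ)..R, v t ^ α * deriv K t := by
      refine intervalIntegral.integral_congr_Ioo_of_le hR.le ?_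
      intro t ht
      simp only [(hKd t ht).deriv]
    rw [h1, hibp]
    apply intervalIntegral.integral_congr_ae
    filter_upwards [hvαd] with t ht htm
    have ht0 : 0 < t := by rw [uIoc_of_le hR.le] at htm; exact htm.1
    rw [ht (uIoc_subset_uIcc htm)]
    have : t ^ (N - 1) = t ^ ((N - 1) / p) * t ^ ((N - 1) / q) := by
      rw [← Real.rpow_add ht0]; congr 1
      have := hpq.inv_add_inv_eq_one
      rw [div_eq_mul_inv, div_eq_mul_inv, ← mul_add, this, mul_one]
    simp only [hK]
    rw [this]
    ring
  -- lower bound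
  set L : ℝ → ℝ := fun t => (rho N q (T t) + rho N q (T t) * |T t| ^ q) * D t with hL
  have hGJc : ContinuousOn (fun t => GG N q (T t) + JJ N q (T t)) (Icc 0 R) :=
    ((GG_cont hN hq1).comp_continuousOn hTc).add ((JJ_cont hN hq1).comp_continuousOn hTc)
  have hGJd : ∀ t ∈ Ioo 0 R, HasDerivAt (fun t => GG N q (T t) + JJ N q (T t)) (L t) t := by
    intro t ht
    exact (((GG_strictDeriv hN hq1 (T t)).hasDerivAt.comp t (hTd t ht)).add
      ((JJ_deriv hN hq1 (T t)).comp t (hTd t ht))).congr_deriv (by simp only [hL, hD]; ring)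
  have hL0 : ∀ t ∈ Ioo 0 R, 0 ≤ L t := by
    intro t ht
    have := rho_nonneg N q (T t)
    have := hD0 t
    simp only [hL]; positivity
  have hLi : IntervalIntegrable L volume 0 R :=
    intervalIntegral.intervalIntegrable_deriv_of_nonneg (huIcc ▸ hGJc) (hmin ▸ hGJd) (hmin ▸ hL0)
  have hLint : ∫ t in (0:ℝ)..R, L t = GG N q S + JJ N q S := by
    rw [intervalIntegral.integral_eq_sub_of_hasDerivAt_of_le hR.le hGJc hGJd hLi, hTR, hT0,
      GG_zero, JJ_zero]
    ring
  have hlow : N * m ^ (1 - 1 / N) * (GG N q S + JJ N q S) ≤ ∫ t in (0:ℝ)..R, v t ^ α * K' t := by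
    rw [← hLint, ← intervalIntegral.integral_const_mul]
    refine intervalIntegral.integral_mono_on_of_le_Ioo hR.le (hLi.const_mul _)
      (hK'i.continuousOn_mul hvαac.continuousOn) ?_
    intro t ht
    have := amgm (q := q) hN hP (by linarith : 0 < α) hαP hm ht.1 (hTpos t ht)
      (hv0 t (Ioo_subset_Icc_self ht))
    simp only [hL, hK', hD]
    rw [hfeq t (Ioo_subset_Icc_self ht)]
    exact this
  -- Holder
  have hb_c : ContinuousOn (fun t => v t ^ (α - 1) * T t * t ^ ((N - 1) / q)) (Icc 0 R) := by
    refine ContinuousOn.mul (ContinuousOn.mul ?_ hTc) ?_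
    · exact (hvc.rpow_const fun _ => Or.inr (by linarith)).continuousOn
    · refine (continuous_id.rpow_const fun _ => Or.inr ?_).continuousOn
      have : 0 ≤ N - 1 := by linarith
      positivity
  have hbq : ∀ t ∈ Icc 0 R, (v t ^ (α - 1) * T t * t ^ ((N - 1) / q)) ^ q = f t * |T t| ^ q := by
    intro t ht
    have h1 := hv0 t ht
    have h2 := hTnn t ht
    have h3 := ht.1
    rw [hfeq t ht, Real.mul_rpow (by positivity) (by positivity),
      Real.mul_rpow (by positivity) (by positivity), ← Real.rpow_mul h1, ← Real.rpow_mul h3, hαq,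
      abs_of_nonneg h2, div_mul_cancel₀ _ (by linarith : q ≠ 0)]
    ring
  have haq : ∀ t ∈ Icc 0 R, (w t * t ^ ((N - 1) / p)) ^ p = w t ^ p * t ^ (N - 1) := by
    intro t ht
    have h3 := ht.1
    rw [Real.mul_rpow (hw0 t) (by positivity), ← Real.rpow_mul h3,
      div_mul_cancel₀ _ (by linarith : p ≠ 0)]
  have hfT : ContinuousOn (fun t => f t * |T t| ^ q) (Icc 0 R) :=
    hfc.continuousOn.mul (hTc.abs.rpow_const fun _ _ => Or.inr (by linarith))
  have hJint : ∫ t in (0:ℝ)..R, f t * |T t| ^ q = m * JJ N q S := by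
    rw [intervalIntegral.integral_eq_sub_of_hasDerivAt_of_le hR.le
      (f := fun t => m * JJ N q (T t)), hTR, hT0, JJ_zero]
    · ring
    · exact continuousOn_const.mul ((JJ_cont hN hq1).comp_continuousOn hTc)
    · intro t ht
      have hρ := rho_pos N q (hTpos t ht)
      refine (((JJ_deriv hN hq1 (T t)).comp t (hTd t ht)).const_mul m).congr_deriv ?_
      field_simp
    · exact (huIcc ▸ hfT).intervalIntegrable
  set μ : Measure ℝ := volume.restrict (Ioc 0 R) with hμ
  have hmemIoc : ∀ᵐ t ∂μ, t ∈ Icc 0 R := by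
    filter_upwards [ae_restrict_mem measurableSet_Ioc] with t ht using Ioc_subset_Icc_self ht
  have ha0 : ∀ᵐ t ∂μ, 0 ≤ w t * t ^ ((N - 1) / p) := by
    filter_upwards [hmemIoc] with t ht
    exact mul_nonneg (hw0 t) (Real.rpow_nonneg ht.1 _)
  have hb0 : ∀ᵐ t ∂μ, 0 ≤ v t ^ (α - 1) * T t * t ^ ((N - 1) / q) := by
    filter_upwards [hmemIoc] with t ht
    exact mul_nonneg (mul_nonneg (Real.rpow_nonneg (hv0 t ht) _) (hTnn t ht))
      (Real.rpow_nonneg ht.1 _)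
  have hp0 : ENNReal.ofReal p ≠ 0 := by simp; linarith
  have hq0 : ENNReal.ofReal q ≠ 0 := by simp; linarith
  have hma : MemLp (fun t => w t * t ^ ((N - 1) / p)) (ENNReal.ofReal p) μ := by
    have hmeas : AEStronglyMeasurable (fun t => w t * t ^ ((N - 1) / p)) μ := by
      refine (hwi.aestronglyMeasurable.restrict).mul ?_
      exact (Measurable.pow_const measurable_id _).aestronglyMeasurable
    rw [← integrable_norm_rpow_iff hmeas hp0 ENNReal.ofReal_ne_top,
      ENNReal.toReal_ofReal (by linarith)]
    refine ((intervalIntegrable_iff_integrableOn_Ioc_of_le hR.le).1 hwp).congr ?_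
    filter_upwards [hmemIoc, ha0] with t ht ht0
    rw [Real.norm_of_nonneg ht0, haq t ht]
  have hmb : MemLp (fun t => v t ^ (α - 1) * T t * t ^ ((N - 1) / q)) (ENNReal.ofReal q) μ := by
    have hmeas : AEStronglyMeasurable (fun t => v t ^ (α - 1) * T t * t ^ ((N - 1) / q)) μ :=
      (hb_c.mono Ioc_subset_Icc_self).aestronglyMeasurable measurableSet_Ioc
    rw [← integrable_norm_rpow_iff hmeas hq0 ENNReal.ofReal_ne_top,
      ENNReal.toReal_ofReal (by linarith)]
    have : IntervalIntegrable (fun t => f t * |T t| ^ q) volume 0 R :=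
      (huIcc ▸ hfT).intervalIntegrable
    refine ((intervalIntegrable_iff_integrableOn_Ioc_of_le hR.le).1 this).congr ?_
    filter_upwards [hmemIoc, hb0] with t ht ht0
    rw [Real.norm_of_nonneg ht0, hbq t ht]
  have hhol := integral_mul_le_Lp_mul_Lq_of_nonneg hpq ha0 hb0 hma hmb
  have hia : ∫ t, (w t * t ^ ((N - 1) / p)) ^ p ∂μ = ∫ t in (0:ℝ)..R, w t ^ p * t ^ (N - 1) := by
    rw [intervalIntegral.integral_of_le hR.le]
    apply integral_congr_ae
    filter_upwards [hmemIoc] with t ht using haq t ht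
  have hib : ∫ t, (v t ^ (α - 1) * T t * t ^ ((N - 1) / q)) ^ q ∂μ = m * JJ N q S := by
    rw [← hJint, intervalIntegral.integral_of_le hR.le]
    apply integral_congr_ae
    filter_upwards [hmemIoc] with t ht using hbq t ht
  rw [hia, hib] at hhol
  refine hlow.trans ?_
  rw [hibp2, intervalIntegral.integral_const_mul, intervalIntegral.integral_of_le hR.le]
  exact mul_le_mul_of_nonneg_left hhol (by linarith)

end Bliss

namespace Bliss

open Set Filter Topology

lemma core2 {N p : ℝ} (hp1 : 1 < p) (hpN : p < N) {R : ℝ} (hR : 0 < R)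
    {w : ℝ → ℝ} (hw0 : ∀ t, 0 ≤ w t) (hwi : Integrable w)
    (hwp : IntervalIntegrable (fun t => w t ^ p * t ^ (N - 1)) volume 0 R) :
    (∫ t in (0:ℝ)..R, |∫ s in t..R, w s| ^ (p * N / (N - p)) * |t| ^ (N - 1)) ^
        ((N - p) / (p * N)) ≤
      (1 / N) * (N * (p - 1) / (N - p)) ^ ((p - 1) / p) *
        (ProbabilityTheory.beta (N - N / p) (N / p) / (p / (p - 1))) ^ (-(1 / N)) *
      (∫ t in (0:ℝ)..R, w t ^ p * t ^ (N - 1)) ^ (1 / p) := by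
  have hN : 1 < N := hp1.trans hpN
  have hNp : 0 < N - p := by linarith
  have hp0 : 0 < p := by linarith
  have hN0 : 0 < N := by linarith
  have hpm : 0 < p - 1 := by linarith
  have hNm : 0 < N - 1 := by linarith
  set q := p / (p - 1) with hq
  have hpq : p.HolderConjugate q := Real.HolderConjugate.conjExponent hp1
  have hq1 : 1 < q := hpq.symm.lt
  have hq0 : 0 < q := by linarith
  set P := p * N / (N - p) with hP
  have hP0 : 0 < P := by positivity
  have hPi : (N - p) / (p * N) = 1 / P := by rw [hP]; field_simp
  have hqi : (p - 1) / p = 1 / q := by rw [hq]; field_simp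
  set α := p * (N - 1) / (N - p) with hα
  set β := N * (p - 1) / (N - p) with hβ
  have hβ0 : 0 < β := by positivity
  have hαβ : α = 1 + β := by rw [hα, hβ]; field_simp; ring
  have hαP : α + P / N = P := by rw [hα, hP]; field_simp; ring
  have hαq : (α - 1) * q = P := by
    rw [hαβ, add_sub_cancel_left, hβ, hP, hq]; field_simp
  set a := N - N / p with ha
  set b := N / p with hb
  have hb0 : 0 < b := by positivity
  have haeq : a = N * (p - 1) / p := by rw [ha, hb]; field_simp
  have ha0 : 0 < a := by rw [haeq]; positivity
  have hab : a + b = N := by rw [ha]; ring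
  have haq : q * a = N := by rw [haeq, hq]; field_simp
  have hB := ProbabilityTheory.beta_pos ha0 hb0
  set G := ProbabilityTheory.beta a b / q with hG
  have hG0 : 0 < G := by positivity
  set A := ∫ t in (0:ℝ)..R, w t ^ p * t ^ (N - 1) with hA
  set M := ∫ t in (0:ℝ)..R, |∫ s in t..R, w s| ^ P * |t| ^ (N - 1) with hM
  have hA0 : 0 ≤ A := by
    apply intervalIntegral.integral_nonneg hR.le
    intro t ht
    exact mul_nonneg (Real.rpow_nonneg (hw0 t) _) (Real.rpow_nonneg ht.1 _)
  have hM0 : 0 ≤ M := by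
    apply intervalIntegral.integral_nonneg hR.le
    intro t ht
    positivity
  rw [hPi, hqi]
  rcases hM0.eq_or_lt with h | hMpos
  · rw [← h, Real.zero_rpow (by positivity)]
    positivity
  have hGt : Tendsto (GG N q) atTop (𝓝 G) := GG_tendsto hN hq1 ha0 hb0 hab haq
  have hNq : N < (N - 1) * q := by
    rw [hq, mul_div_assoc', lt_div_iff₀ hpm]; nlinarith
  have hβeq : N / ((N - 1) * q - N) = β := by
    have h1 : (N - 1) * q - N = (N - p) / (p - 1) := by rw [hq]; field_simp; ring
    rw [h1, hβ]; field_simp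
  have hJt : Tendsto (JJ N q) atTop (𝓝 (β * G)) := by
    have h1 : Tendsto (fun S => (N * GG N q S - S ^ N * (1 + S ^ q) ^ (1 - N)) /
        ((N - 1) * q - N)) atTop (𝓝 ((N * G - 0) / ((N - 1) * q - N))) :=
      ((hGt.const_mul N).sub (bdry_tendsto hN hNq)).div_const _
    have h2 : (N * G - 0) / ((N - 1) * q - N) = β * G := by
      rw [← hβeq]; ring
    rw [h2] at h1
    refine h1.congr' ?_
    filter_upwards [eventually_ge_atTop 0] with S hS
    rw [← JJ_ident hN hq1 hS]
    have : (N - 1) * q - N ≠ 0 := by linarith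
    field_simp
    ring
  have hmt : Tendsto (fun S => M / GG N q S) atTop (𝓝 (M / G)) := tendsto_const_nhds.div hGt hG0.ne'
  have hm0 : 0 < M / G := by positivity
  have hlim : N * (M / G) ^ (1 - 1 / N) * (G + β * G) ≤
      α * (A ^ (1 / p) * (M / G * (β * G)) ^ (1 / q)) := by
    refine le_of_tendsto_of_tendsto
      (((hmt.rpow_const (Or.inl hm0.ne')).const_mul N).mul (hGt.add hJt))
      ((((hmt.mul hJt).rpow_const (Or.inl (by positivity))).const_mul (A ^ (1 / p))).const_mul α) ?_
    filter_upwards [eventually_gt_atTop 0] with S hS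
    have hGS := GG_pos hN hq1 hS
    exact core hN hpq (by rw [hαβ]; linarith) hP0 hαP hαq hR hS hw0 hwi hwp
      (m := M / GG N q S) (by positivity) (by rw [← hM]; field_simp)
  have e1 : (M / G) ^ (1 - 1 / N) = M ^ (1 / P) * M ^ (1 / q) * (G ^ (1 / N) / G) := by
    rw [Real.div_rpow hMpos.le hG0.le, ← Real.rpow_add hMpos, Real.rpow_sub hG0, Real.rpow_one,
      show 1 - 1 / N = 1 / P + 1 / q by rw [hP, hq]; field_simp; ring]
    field_simp
  have e2 : (M / G * (β * G)) ^ (1 / q) = M ^ (1 / q) * β ^ (1 / q) := by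
    rw [← Real.mul_rpow hMpos.le hβ0.le]; congr 1; field_simp
  rw [e1, e2, hαβ] at hlim
  have hMq : 0 < M ^ (1 / q) := by positivity
  have hGN : 0 < G ^ (1 / N) := by positivity
  rw [Real.rpow_neg hG0.le]
  have h3 : ((1 + β) * M ^ (1 / q)) * (N * M ^ (1 / P) * G ^ (1 / N)) ≤
      ((1 + β) * M ^ (1 / q)) * (A ^ (1 / p) * β ^ (1 / q)) := by
    calc _ = N * (M ^ (1 / P) * M ^ (1 / q) * (G ^ (1 / N) / G)) * (G + β * G) := by field_simp
      _ ≤ _ := hlim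
      _ = _ := by ring
  have h4 := le_of_mul_le_mul_left h3 (by positivity)
  calc M ^ (1 / P) = (N * M ^ (1 / P) * G ^ (1 / N)) * (1 / N * (G ^ (1 / N))⁻¹) := by field_simp
    _ ≤ (A ^ (1 / p) * β ^ (1 / q)) * (1 / N * (G ^ (1 / N))⁻¹) := by gcongr
    _ = _ := by ring

lemma sigma_pos {N : ℝ} (hN : 1 < N) : 0 < N * omegaN N := by
  have : 0 < Real.Gamma (N / 2 + 1) := Real.Gamma_pos_of_pos (by linarith)
  have := Real.pi_pos
  unfold omegaN
  positivity

lemma Eucl_pos {N p : ℝ} (hp1 : 1 < p) (hpN : p < N) : 0 < Eucl N p := by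
  have hN : 1 < N := hp1.trans hpN
  have hs := sigma_pos hN
  have h1 : 0 < Real.Gamma (N + 1) := Real.Gamma_pos_of_pos (by linarith)
  have h2 : 0 < Real.Gamma (N / p) := Real.Gamma_pos_of_pos (by apply div_pos <;> linarith)
  have h3 : 0 < Real.Gamma (N + 1 - N / p) := by
    apply Real.Gamma_pos_of_pos
    have : N / p < N := div_lt_self (by linarith) hp1
    linarith
  have h4 : 0 < N - p := by linarith
  have h5 : 0 < p - 1 := by linarith
  have h6 : 0 < N := by linarith
  unfold Eucl
  positivity

lemma const_eq {N p : ℝ} (hp1 : 1 < p) (hpN : p < N) :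
    (1 / N) * (N * (p - 1) / (N - p)) ^ ((p - 1) / p) *
        (ProbabilityTheory.beta (N - N / p) (N / p) / (p / (p - 1))) ^ (-(1 / N)) =
      Eucl N p * (N * omegaN N) ^ (1 / N) := by
  have hN : 1 < N := hp1.trans hpN
  have hs := sigma_pos hN
  have hp0 : 0 < p := by linarith
  have hN0 : 0 < N := by linarith
  have hpm : 0 < p - 1 := by linarith
  have haeq : N - N / p = N * (p - 1) / p := by field_simp
  have ha0 : 0 < N - N / p := by rw [haeq]; positivity
  have hb0 : 0 < N / p := by positivity
  have h1 : 0 < Real.Gamma N := Real.Gamma_pos_of_pos hN0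
  have h2 : 0 < Real.Gamma (N / p) := Real.Gamma_pos_of_pos hb0
  have h3 : 0 < Real.Gamma (N - N / p) := Real.Gamma_pos_of_pos ha0
  have e1 : Real.Gamma (N + 1) = N * Real.Gamma N := Real.Gamma_add_one hN0.ne'
  have e2 : Real.Gamma (N + 1 - N / p) = (N * (p - 1) / p) * Real.Gamma (N - N / p) := by
    rw [show N + 1 - N / p = (N - N / p) + 1 by ring, Real.Gamma_add_one ha0.ne', haeq]
  have hB := ProbabilityTheory.beta_pos ha0 hb0
  unfold Eucl
  rw [mul_assoc (1 / N * _), Real.rpow_neg (by positivity), ← Real.inv_rpow (by positivity), e1, e2,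
    ← Real.mul_rpow (by positivity) hs.le]
  congr 2
  rw [ProbabilityTheory.beta, sub_add_cancel]
  have := hs.ne'
  generalize N * omegaN N = σ at *
  field_simp

end Bliss

namespace Bliss

open Set Filter Topology

lemma step {N p : ℝ} (hp1 : 1 < p) (hpN : p < N) {u u' : ℝ → ℝ}
    (hloc : ∀ b : ℝ, IntegrableOn u' (Set.Icc 0 b))
    (hac : ∀ a b : ℝ, 0 ≤ a → a ≤ b → u b - u a = ∫ t in a..b, u' t)
    (hfin : ∫⁻ t in Ioi (0 : ℝ), ENNReal.ofReal (|u' t| ^ p * t ^ (N - 1)) ≠ ⊤)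
    {R : ℝ} (hR : 0 < R) :
    (ENNReal.ofReal (N * omegaN N) * ∫⁻ t in Ioc 0 R,
      ENNReal.ofReal (|u t - u R| ^ (p * N / (N - p)) * t ^ (N - 1))) ^ ((N - p) / (p * N)) ≤
      ENNReal.ofReal (Eucl N p) *
        (ENNReal.ofReal (N * omegaN N) *
            ∫⁻ t in Ioi (0 : ℝ), ENNReal.ofReal (|u' t| ^ p * t ^ (N - 1))) ^ (1 / p) := by
  have hN : 1 < N := hp1.trans hpN
  have hNp : 0 < N - p := by linarith
  have hp0 : 0 < p := by linarith
  have hN0 : 0 < N := by linarith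
  have hσ := sigma_pos hN
  have hE := Eucl_pos hp1 hpN
  set w : ℝ → ℝ := (Icc 0 R).indicator (fun t => |u' t|) with hw
  have hw0 : ∀ t, 0 ≤ w t := fun t => indicator_nonneg (fun _ _ => abs_nonneg _) t
  have hwi : Integrable w := (integrable_indicator_iff measurableSet_Icc).2 (hloc R).abs
  have hweq : ∀ t ∈ Icc 0 R, w t = |u' t| := fun t ht => indicator_of_mem ht _
  have hmeas : AEStronglyMeasurable (fun t => w t ^ p * t ^ (N - 1)) (volume.restrict (Ioc 0 R)) := by
    refine AEMeasurable.aestronglyMeasurable ?_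
    exact (hwi.aestronglyMeasurable.aemeasurable.restrict.pow_const p).mul
      (Measurable.pow_const measurable_id _).aemeasurable
  have hnn : 0 ≤ᵐ[volume.restrict (Ioc 0 R)] (fun t => w t ^ p * t ^ (N - 1)) := by
    filter_upwards [ae_restrict_mem measurableSet_Ioc] with t ht
    exact mul_nonneg (Real.rpow_nonneg (hw0 t) _) (Real.rpow_nonneg ht.1.le _)
  have hAle : ∫⁻ t in Ioc 0 R, ENNReal.ofReal (w t ^ p * t ^ (N - 1)) ≤
      ∫⁻ t in Ioi (0 : ℝ), ENNReal.ofReal (|u' t| ^ p * t ^ (N - 1)) := by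
    calc _ = ∫⁻ t in Ioc 0 R, ENNReal.ofReal (|u' t| ^ p * t ^ (N - 1)) := by
          refine setLIntegral_congr_fun measurableSet_Ioc ?_
          intro t ht
          simp only [hweq t (Ioc_subset_Icc_self ht)]
      _ ≤ _ := lintegral_mono_set Ioc_subset_Ioi_self
  have hwpI : IntegrableOn (fun t => w t ^ p * t ^ (N - 1)) (Ioc 0 R) := by
    refine ⟨hmeas, ?_⟩
    rw [hasFiniteIntegral_iff_ofReal hnn]
    exact hAle.trans_lt hfin.lt_top
  have hwp : IntervalIntegrable (fun t => w t ^ p * t ^ (N - 1)) volume 0 R :=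
    (intervalIntegrable_iff_integrableOn_Ioc_of_le hR.le).2 hwpI
  have key := core2 hp1 hpN hR hw0 hwi hwp
  rw [const_eq hp1 hpN] at key
  set P := p * N / (N - p) with hP
  have hP0 : 0 < P := by positivity
  have hPi : (N - p) / (p * N) = 1 / P := by rw [hP]; field_simp
  rw [hPi] at key ⊢
  set A := ∫ t in (0:ℝ)..R, w t ^ p * t ^ (N - 1) with hA
  set M := ∫ t in (0:ℝ)..R, |∫ s in t..R, w s| ^ P * |t| ^ (N - 1) with hM
  have hM0 : 0 ≤ M := intervalIntegral.integral_nonneg hR.le fun t ht => by positivity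
  have hA0 : 0 ≤ A := intervalIntegral.integral_nonneg hR.le fun t ht =>
    mul_nonneg (Real.rpow_nonneg (hw0 t) _) (Real.rpow_nonneg ht.1 _)
  have hAof : ENNReal.ofReal A ≤
      ∫⁻ t in Ioi (0 : ℝ), ENNReal.ofReal (|u' t| ^ p * t ^ (N - 1)) := by
    rw [hA, intervalIntegral.integral_of_le hR.le, ofReal_integral_eq_lintegral_ofReal hwpI hnn]
    exact hAle
  have hvc : Continuous fun t => ∫ s in t..R, w s := by
    have : (fun t => ∫ s in t..R, w s) = fun t => - ∫ s in R..t, w s := by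
      funext t; rw [intervalIntegral.integral_symm]
    rw [this]
    exact (intervalIntegral.continuous_primitive (fun a b => hwi.intervalIntegrable) R).neg
  have hMof : ∫⁻ t in Ioc 0 R, ENNReal.ofReal (|u t - u R| ^ P * t ^ (N - 1)) ≤
      ENNReal.ofReal M := by
    have hc : Continuous fun t => |∫ s in t..R, w s| ^ P * |t| ^ (N - 1) :=
      (hvc.abs.rpow_const fun _ => Or.inr hP0.le).mul
        (continuous_abs.rpow_const fun _ => Or.inr (by linarith))
    rw [hM, intervalIntegral.integral_of_le hR.le, ofReal_integral_eq_lintegral_ofReal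
      ((intervalIntegrable_iff_integrableOn_Ioc_of_le hR.le).1 (hc.intervalIntegrable _ _))
      (ae_of_all _ fun t => by positivity)]
    refine setLIntegral_mono_ae' measurableSet_Ioc (ae_of_all _ fun t ht => ?_)
    apply ENNReal.ofReal_le_ofReal
    have ht0 : 0 < t := ht.1
    rw [abs_of_pos ht0]
    have h1 : |u t - u R| ≤ |∫ s in t..R, w s| := by
      rw [abs_sub_comm, hac t R ht0.le ht.2]
      refine (intervalIntegral.abs_integral_le_integral_abs ht.2).trans ((le_abs_self _).trans_eq' ?_)
      apply intervalIntegral.integral_congr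
      intro s hs
      rw [uIcc_of_le ht.2] at hs
      exact hweq s ⟨ht0.le.trans hs.1, hs.2⟩
    gcongr
  calc _ ≤ (ENNReal.ofReal (N * omegaN N) * ENNReal.ofReal M) ^ (1 / P) := by gcongr
    _ = ENNReal.ofReal ((N * omegaN N * M) ^ (1 / P)) := by
      rw [← ENNReal.ofReal_mul hσ.le, ENNReal.ofReal_rpow_of_nonneg (by positivity) (by positivity)]
    _ ≤ ENNReal.ofReal (Eucl N p * (N * omegaN N * A) ^ (1 / p)) := by
      apply ENNReal.ofReal_le_ofReal
      rw [Real.mul_rpow hσ.le hM0, Real.mul_rpow hσ.le hA0]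
      calc _ ≤ (N * omegaN N) ^ (1 / P) *
            (Eucl N p * (N * omegaN N) ^ (1 / N) * A ^ (1 / p)) := by gcongr
        _ = Eucl N p * ((N * omegaN N) ^ (1 / P) * (N * omegaN N) ^ (1 / N)) * A ^ (1 / p) := by
          ring
        _ = _ := by
          rw [← Real.rpow_add hσ, show 1 / P + 1 / N = 1 / p by rw [hP]; field_simp; ring]
          ring
    _ = ENNReal.ofReal (Eucl N p) * (ENNReal.ofReal (N * omegaN N) * ENNReal.ofReal A) ^ (1 / p) := by
      rw [ENNReal.ofReal_mul hE.le, ← ENNReal.ofReal_mul hσ.le,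
        ENNReal.ofReal_rpow_of_nonneg (by positivity) (by positivity)]
    _ ≤ _ := by gcongr

end Bliss

/-- **Bliss inequality.** For `N ∈ (1,∞)`, `p ∈ (1,N)`, `p* = pN/(N-p)` and any locally
absolutely continuous `u : [0,∞) → ℝ` with a.e. derivative `u'` and `u(t) → 0` as `t → ∞`,
`(σ_{N-1} ∫₀^∞ |u|^{p*} t^{N-1} dt)^{1/p*} ≤ Eucl(N,p) (σ_{N-1} ∫₀^∞ |u'|^p t^{N-1} dt)^{1/p}`
as an inequality in `[0,∞]`. -/
theorem bliss_inequality (N p : ℝ) (hN : 1 < N) (hp1 : 1 < p) (hpN : p < N)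
    (u u' : ℝ → ℝ)
    (hloc : ∀ b : ℝ, IntegrableOn u' (Set.Icc 0 b))
    (hac : ∀ a b : ℝ, 0 ≤ a → a ≤ b → u b - u a = ∫ t in a..b, u' t)
    (hlim : Filter.Tendsto u Filter.atTop (nhds 0)) :
    (ENNReal.ofReal (N * omegaN N) *
        ∫⁻ t in Set.Ioi (0 : ℝ),
          ENNReal.ofReal (|u t| ^ (p * N / (N - p)) * t ^ (N - 1))) ^ ((N - p) / (p * N)) ≤
      ENNReal.ofReal (Eucl N p) *
        (ENNReal.ofReal (N * omegaN N) *
            ∫⁻ t in Set.Ioi (0 : ℝ),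
              ENNReal.ofReal (|u' t| ^ p * t ^ (N - 1))) ^ (1 / p) := by
  classical
  have hNp : 0 < N - p := by linarith
  have hp0 : 0 < p := by linarith
  have hN0 : 0 < N := by linarith
  have hσ := Bliss.sigma_pos hN
  have hE := Bliss.Eucl_pos hp1 hpN
  by_cases hfin : ∫⁻ t in Set.Ioi (0 : ℝ), ENNReal.ofReal (|u' t| ^ p * t ^ (N - 1)) = ⊤
  · rw [hfin, ENNReal.mul_top (by simpa using hσ), ENNReal.top_rpow_of_pos (by positivity),
      ENNReal.mul_top (by simpa using hE)]
    exact le_top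
  have hst := fun (R : ℝ) (hR : 0 < R) => Bliss.step hp1 hpN hloc hac hfin hR
  set B := ENNReal.ofReal (Eucl N p) *
        (ENNReal.ofReal (N * omegaN N) *
            ∫⁻ t in Set.Ioi (0 : ℝ),
              ENNReal.ofReal (|u' t| ^ p * t ^ (N - 1))) ^ (1 / p) with hB
  set P := p * N / (N - p) with hP
  have hP0 : 0 < P := by positivity
  have hPi : (N - p) / (p * N) = P⁻¹ := by rw [hP, inv_div]
  rw [hPi] at hst ⊢
  rw [ENNReal.rpow_inv_le_iff hP0]
  have hσ0 : ENNReal.ofReal (N * omegaN N) ≠ 0 := by simpa using hσ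
  have hσt : ENNReal.ofReal (N * omegaN N) ≠ ⊤ := ENNReal.ofReal_ne_top
  rw [mul_comm, ← ENNReal.le_div_iff_mul_le (Or.inl hσ0) (Or.inl hσt)]
  have hst2 : ∀ R : ℝ, 0 < R → ∫⁻ t in Set.Ioc 0 R,
      ENNReal.ofReal (|u t - u R| ^ P * t ^ (N - 1)) ≤ B ^ P / ENNReal.ofReal (N * omegaN N) := by
    intro R hR
    have := hst R hR
    rw [ENNReal.rpow_inv_le_iff hP0, mul_comm] at this
    rwa [ENNReal.le_div_iff_mul_le (Or.inl hσ0) (Or.inl hσt)]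
  -- measurability of u
  have hu : ContinuousOn u (Set.Ici 0) := by
    intro t ht
    have ht : 0 ≤ t := ht
    have h1 : ContinuousOn (fun x => ∫ s in (0:ℝ)..x, u' s) (Set.uIcc 0 (t + 1)) := by
      apply intervalIntegral.continuousOn_primitive_interval
      rw [Set.uIcc_of_le (by linarith)]
      exact hloc (t + 1)
    rw [Set.uIcc_of_le (by linarith)] at h1
    have h2 : ContinuousOn u (Set.Icc 0 (t + 1)) := by
      refine (h1.const_add (u 0)).congr ?_
      intro x hx
      have := hac 0 x le_rfl hx.1
      simp only []
      linarith
    refine (h2 t ⟨ht, by linarith⟩).mono_of_mem_nhdsWithin ?_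
    rw [← Set.Ici_inter_Iic]
    exact Filter.inter_mem self_mem_nhdsWithin
      (mem_nhdsWithin_of_mem_nhds (Iic_mem_nhds (by linarith)))
  have hum : AEMeasurable u (volume.restrict (Set.Ioi 0)) :=
    (hu.mono Set.Ioi_subset_Ici_self).aemeasurable measurableSet_Ioi
  set F : ℕ → ℝ → ENNReal := fun n => (Set.Ioc 0 (n : ℝ)).indicator
    (fun t => ENNReal.ofReal (|u t - u n| ^ P * t ^ (N - 1))) with hF
  have hFm : ∀ n, AEMeasurable (F n) (volume.restrict (Set.Ioi 0)) := by
    intro n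
    refine AEMeasurable.indicator ?_ measurableSet_Ioc
    refine AEMeasurable.ennreal_ofReal ?_
    refine AEMeasurable.mul ?_ (Measurable.pow_const measurable_id _).aemeasurable
    exact ((continuous_abs.measurable.comp_aemeasurable (hum.sub_const (u n))).pow_const P)
  have hFle : ∀ n : ℕ, 1 ≤ n → ∫⁻ t in Set.Ioi 0, F n t ≤ B ^ P / ENNReal.ofReal (N * omegaN N) := by
    intro n hn
    have hn' : (0:ℝ) < n := by exact_mod_cast hn
    rw [hF, lintegral_indicator measurableSet_Ioc, Measure.restrict_restrict measurableSet_Ioc,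
      Set.inter_eq_left.2 Set.Ioc_subset_Ioi_self]
    exact hst2 n hn'
  have hFlim : ∀ t ∈ Set.Ioi (0:ℝ), Filter.liminf (fun n => F n t) Filter.atTop =
      ENNReal.ofReal (|u t| ^ P * t ^ (N - 1)) := by
    intro t ht
    apply Filter.Tendsto.liminf_eq
    have h1 : Filter.Tendsto (fun n : ℕ => u n) Filter.atTop (nhds 0) :=
      hlim.comp tendsto_natCast_atTop_atTop
    have h2 : Filter.Tendsto (fun n : ℕ => ENNReal.ofReal (|u t - u n| ^ P * t ^ (N - 1)))
        Filter.atTop (nhds (ENNReal.ofReal (|u t - 0| ^ P * t ^ (N - 1)))) :=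
      ENNReal.tendsto_ofReal
        (((h1.const_sub (u t)).abs.rpow_const (Or.inr hP0.le)).mul_const _)
    rw [sub_zero] at h2
    refine h2.congr' ?_
    filter_upwards [Filter.eventually_ge_atTop ⌈t⌉₊] with n hn
    have : t ∈ Set.Ioc 0 (n : ℝ) := ⟨ht, Nat.ceil_le.1 hn⟩
    simp only [hF, Set.indicator_of_mem this]
  calc ∫⁻ t in Set.Ioi 0, ENNReal.ofReal (|u t| ^ P * t ^ (N - 1))
      = ∫⁻ t in Set.Ioi 0, Filter.liminf (fun n => F n t) Filter.atTop :=
        setLIntegral_congr_fun measurableSet_Ioi fun t ht => (hFlim t ht).symm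
    _ ≤ Filter.liminf (fun n => ∫⁻ t in Set.Ioi 0, F n t) Filter.atTop :=
        lintegral_liminf_le' hFm
    _ ≤ Filter.liminf (fun _ : ℕ => B ^ P / ENNReal.ofReal (N * omegaN N)) Filter.atTop := by
        refine Filter.liminf_le_liminf ?_
        filter_upwards [Filter.eventually_ge_atTop 1] with n hn using hFle n hn
    _ = _ := Filter.liminf_const _
end

section
/- Let n ∈ ℕ with n ≥ 2, let p ∈ (1,n) be real, and set p* := pn/(n−p). Then for every compactly supported continuously differentiable function u : ℝⁿ → ℝ it holds (∫_{ℝⁿ} |u(x)|^{p*} dx)^{1/p*} ≤ Eucl(n,p) · (∫_{ℝⁿ} |∇u(x)|^{p} dx)^{1/p}, where |∇u(x)| denotes the Euclidean norm of the gradient of u at x and dx is the Lebesgue measure. (This is the sharp Euclidean Sobolev inequality, i.e. the Euclidean-space instance, with asymptotic volume ratio equal to 1, of the sharp Sobolev inequality on CD(0,N) spaces with Euclidean volume growth.) -/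
open MeasureTheory

lemma knothe_one {A : Type} [MeasurableSpace A] (L R : ℝ) (hL : 0 < L) (hR : 0 < R)
    (F G : A → ℝ → ℝ) (hFm : Measurable (Function.uncurry F))
    (hGm : Measurable (Function.uncurry G))
    (hFc : ∀ a, Continuous (F a)) (hGc : ∀ a, Continuous (G a))
    (hF0 : ∀ a x, 0 ≤ F a x) (hFs : ∀ a x, x ∉ Set.Icc (-L) L → F a x = 0)
    (hG : ∀ a y, 0 < G a y) :
    ∃ T : A → ℝ → ℝ, Measurable (Function.uncurry T) ∧ (∀ a x, T a x ∈ Set.Icc (-R) R) ∧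
      ∀ a, 0 < ∫ x in Set.Icc (-L) L, F a x →
        (∀ x, HasDerivAt (T a) (F a x * (∫ y in Set.Icc (-R) R, G a y) /
          (G a (T a x) * ∫ x in Set.Icc (-L) L, F a x)) x) ∧
        ∀ φ : ℝ → ENNReal,
          ENNReal.ofReal (∫ y in Set.Icc (-R) R, G a y) *
            ∫⁻ x in Set.Icc (-L) L, ENNReal.ofReal (F a x) * φ (T a x) =
          ENNReal.ofReal (∫ x in Set.Icc (-L) L, F a x) *
            ∫⁻ y in Set.Icc (-R) R, ENNReal.ofReal (G a y) * φ y := by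
  classical
  set c : A → ℝ := fun a => ∫ x in Set.Icc (-L) L, F a x with hc
  set m : A → ℝ := fun a => ∫ y in Set.Icc (-R) R, G a y with hm
  set Ft : A → ℝ → ℝ := fun a x => ∫ t in (-L)..x, F a t with hFt
  set Gt : A → ℝ → ℝ := fun a y => ∫ t in (-R)..y, G a t with hGt
  have hcI : ∀ a, c a = Ft a L := by
    intro a
    simp only [hc, hFt]
    rw [intervalIntegral.integral_of_le (by linarith), integral_Icc_eq_integral_Ioc]
  have hmI : ∀ a, m a = Gt a R := by
    intro a
    simp only [hm, hGt]
    rw [intervalIntegral.integral_of_le (by linarith), integral_Icc_eq_integral_Ioc]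
  have hFd : ∀ a x, HasStrictDerivAt (Ft a) (F a x) x := fun a x =>
    (hFc a).integral_hasStrictDerivAt _ _
  have hGd : ∀ a x, HasStrictDerivAt (Gt a) (G a x) x := fun a x =>
    (hGc a).integral_hasStrictDerivAt _ _
  have hGmono : ∀ a, StrictMono (Gt a) := fun a =>
    strictMono_of_deriv_pos (fun x => by rw [(hGd a x).hasDerivAt.deriv]; exact hG a x)
  have hFmono : ∀ a, Monotone (Ft a) := fun a =>
    monotone_of_deriv_nonneg (fun x => (hFd a x).hasDerivAt.differentiableAt)
      (fun x => by rw [(hFd a x).hasDerivAt.deriv]; exact hF0 a x)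
  have hGtc : ∀ a, Continuous (Gt a) := fun a =>
    continuous_iff_continuousAt.2 fun x => (hGd a x).hasDerivAt.continuousAt
  have hFtc : ∀ a, Continuous (Ft a) := fun a =>
    continuous_iff_continuousAt.2 fun x => (hFd a x).hasDerivAt.continuousAt
  have hF_neg : ∀ a, Ft a (-L) = 0 := fun a => by simp [hFt]
  have hG_neg : ∀ a, Gt a (-R) = 0 := fun a => by simp [hGt]
  have hmpos : ∀ a, 0 < m a := fun a => by
    rw [hmI, ← hG_neg a]; exact hGmono a (by linarith)
  -- values of Ft outside
  have hF_lo : ∀ a x, 0 ≤ Ft a x := by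
    intro a x
    by_cases hx : -L ≤ x
    · rw [← hF_neg a]; exact hFmono a hx
    · push Not at hx
      have : Ft a x = 0 := by
        simp only [hFt]
        apply intervalIntegral.integral_zero_ae
        have h0 : ∀ᵐ t : ℝ, t ≠ -L := by simp [ae_iff, measure_singleton]
        filter_upwards [h0] with t ht1 ht
        apply hFs
        rw [Set.uIoc_of_ge hx.le] at ht
        intro h
        exact ht1 (le_antisymm ht.2 h.1)
      exact this.ge
  have hF_hi : ∀ a x, Ft a x ≤ c a := by
    intro a x
    by_cases hx : x ≤ L
    · rw [hcI]; exact hFmono a hx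
    · push Not at hx
      have : Ft a x - Ft a L = 0 := by
        simp only [hFt]
        rw [intervalIntegral.integral_interval_sub_left]
        · apply intervalIntegral.integral_zero_ae
          refine Filter.Eventually.of_forall fun t ht => ?_
          apply hFs
          rw [Set.uIoc_of_le hx.le] at ht
          intro h
          exact absurd h.2 (not_le.2 ht.1)
        · exact (hFc a).intervalIntegrable _ _
        · exact (hFc a).intervalIntegrable _ _
      rw [hcI]; linarith
  have hex : ∀ a x, ∃ y ∈ Set.Icc (-R) R, 0 < c a → Gt a y = Ft a x * m a / c a := by
    intro a x
    by_cases hca : 0 < c a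
    · have h1 : Ft a x * m a / c a ∈ Set.Icc (Gt a (-R)) (Gt a R) := by
        rw [hG_neg, ← hmI]
        refine ⟨div_nonneg (mul_nonneg (hF_lo a x) (hmpos a).le) hca.le, ?_⟩
        rw [div_le_iff₀ hca, mul_comm]
        exact mul_le_mul_of_nonneg_left (hF_hi a x) (hmpos a).le
      obtain ⟨y, hy, hy2⟩ := intermediate_value_Icc (by linarith : -R ≤ R)
        (hGtc a).continuousOn h1
      exact ⟨y, hy, fun _ => hy2⟩
    · exact ⟨0, ⟨by linarith, hR.le⟩, fun h => absurd h hca⟩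
  choose T0 hT0 hT0' using hex
  let T : A → ℝ → ℝ := fun a x => if 0 < c a then T0 a x else 0
  have hTmem : ∀ a x, T a x ∈ Set.Icc (-R) R := by
    intro a x
    simp only [T]
    split_ifs
    · exact hT0 a x
    · exact ⟨by linarith, hR.le⟩
  have hTeq : ∀ a x, 0 < c a → Gt a (T a x) = Ft a x * m a / c a := by
    intro a x h
    simp only [T, if_pos h]
    exact hT0' a x h
  have hcmeas : Measurable c :=
    (StronglyMeasurable.integral_prod_right (ν := volume.restrict (Set.Icc (-L) L))
      hFm.stronglyMeasurable).measurable
  have hmmeas : Measurable m :=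
    (StronglyMeasurable.integral_prod_right (ν := volume.restrict (Set.Icc (-R) R))
      hGm.stronglyMeasurable).measurable
  have hFtm1 : ∀ x, Measurable (fun a => Ft a x) := by
    intro x
    simp only [hFt, intervalIntegral]
    exact ((StronglyMeasurable.integral_prod_right (ν := volume.restrict (Set.Ioc (-L) x))
      hFm.stronglyMeasurable).measurable).sub
      (StronglyMeasurable.integral_prod_right (ν := volume.restrict (Set.Ioc x (-L)))
      hFm.stronglyMeasurable).measurable
  have hGtm1 : ∀ x, Measurable (fun a => Gt a x) := by
    intro x
    simp only [hGt, intervalIntegral]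
    exact ((StronglyMeasurable.integral_prod_right (ν := volume.restrict (Set.Ioc (-R) x))
      hGm.stronglyMeasurable).measurable).sub
      (StronglyMeasurable.integral_prod_right (ν := volume.restrict (Set.Ioc x (-R)))
      hGm.stronglyMeasurable).measurable
  have hFtm : Measurable (Function.uncurry Ft) := by
    have := measurable_uncurry_of_continuous_of_measurable (u := fun x a => Ft a x)
      (fun a => hFtc a) hFtm1
    exact this.comp measurable_swap
  have hTm : Measurable (Function.uncurry T) := by
    apply measurable_of_Iic
    intro y
    have : Function.uncurry T ⁻¹' Set.Iic y =
        ({q : A × ℝ | 0 < c q.1} ∩ {q | Ft q.1 q.2 * m q.1 / c q.1 ≤ Gt q.1 y}) ∪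
        ({q : A × ℝ | ¬ 0 < c q.1} ∩ {q | (0:ℝ) ≤ y}) := by
      ext ⟨a, x⟩
      simp only [Set.mem_preimage, Function.uncurry_apply_pair, Set.mem_Iic, Set.mem_union,
        Set.mem_inter_iff, Set.mem_ofPred_eq]
      by_cases h : 0 < c a
      · simp only [h, true_and, not_true, false_and, or_false]
        rw [← hTeq a x h, (hGmono a).le_iff_le]
      · simp [h, T]
    rw [this]
    have hc1 : Measurable (fun q : A × ℝ => c q.1) := hcmeas.comp measurable_fst
    have hs : MeasurableSet {q : A × ℝ | 0 < c q.1} := measurableSet_lt measurable_const hc1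
    refine (hs.inter ?_).union (hs.compl.inter (MeasurableSet.const _))
    exact measurableSet_le ((hFtm.mul (hmmeas.comp measurable_fst)).div hc1)
      ((hGtm1 y).comp measurable_fst)
  refine ⟨T, hTm, hTmem, fun a hca => ?_⟩
  have hca' : 0 < c a := hca
  have hder : ∀ x, HasDerivAt (T a) (F a x * m a / (G a (T a x) * c a)) x := by
    intro x
    set y := T a x with hy
    have hinv := (hGd a y).to_localInverse (hG a y).ne'
    have hr := (hGd a y).eventually_right_inverse (hG a y).ne'
    have hh : HasDerivAt (fun x => Ft a x * m a / c a) (F a x * m a / c a) x :=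
      (((hFd a x).hasDerivAt.mul_const _).div_const _)
    rw [hTeq a x hca'] at hinv hr
    have h1 := hinv.hasDerivAt.comp x hh
    have h2 : T a =ᶠ[nhds x] (HasStrictDerivAt.localInverse (Gt a) (G a y) y (hGd a y)
        (hG a y).ne') ∘ (fun x => Ft a x * m a / c a) := by
      filter_upwards [hh.continuousAt.eventually hr] with z hz
      apply (hGmono a).injective
      rw [hTeq a z hca']
      exact hz.symm
    have h3 : F a x * m a / (G a y * c a) = (G a y)⁻¹ * (F a x * m a / c a) := by
      rw [inv_mul_eq_div, div_div, mul_comm (c a)]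
    rw [h3]
    exact h1.congr_of_eventuallyEq h2
  refine ⟨hder, fun φ => ?_⟩
  have hTmono : Monotone (T a) := by
    intro x x' hxx
    rw [← (hGmono a).le_iff_le, hTeq a x hca', hTeq a x' hca']
    have := hFmono a hxx
    have := (hmpos a).le
    gcongr
  have himg : Set.image (T a) (Set.Icc (-L) L) = Set.Icc (-R) R := by
    apply Set.Subset.antisymm
    · rintro _ ⟨x, _, rfl⟩
      exact hTmem a x
    · have hTc : ContinuousOn (T a) (Set.Icc (-L) L) := fun x _ =>
        (hder x).continuousAt.continuousWithinAt
      have := intermediate_value_Icc (by linarith : -L ≤ L) hTc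
      have e1 : T a (-L) = -R := by
        apply (hGmono a).injective
        rw [hTeq a _ hca', hF_neg, hG_neg]; simp
      have e2 : T a L = R := by
        apply (hGmono a).injective
        rw [hTeq a _ hca', ← hcI, ← hmI]; field_simp
      rwa [e1, e2] at this
  have key := lintegral_image_eq_lintegral_deriv_mul_of_monotoneOn
    (s := Set.Icc (-L) L) (f := T a) measurableSet_Icc
    (fun x _ => (hder x).hasDerivWithinAt) (hTmono.monotoneOn _)
    (fun y => ENNReal.ofReal (G a y) * φ y)
  rw [himg] at key
  rw [key, ← lintegral_const_mul' _ _ ENNReal.ofReal_ne_top,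
    ← lintegral_const_mul' _ _ ENNReal.ofReal_ne_top]
  apply lintegral_congr
  intro x
  rw [← mul_assoc, ← mul_assoc, ← mul_assoc, ← ENNReal.ofReal_mul (hmpos a).le,
    ← ENNReal.ofReal_mul hca'.le,
    ← ENNReal.ofReal_mul (by
      have := hF0 a x; have := hmpos a; have := hG a (T a x); positivity)]
  congr 2
  have := (hG a (T a x)).ne'
  simp only [c, m]
  field_simp

/-- The cube `[-R,R]^n`. -/
def kcube (n : ℕ) (R : ℝ) : Set (Fin n → ℝ) := Set.Icc (fun _ => -R) (fun _ => R)

lemma kcube_compact (n : ℕ) (R : ℝ) : IsCompact (kcube n R) := isCompact_Icc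

lemma kcube_meas (n : ℕ) (R : ℝ) : MeasurableSet (kcube n R) := measurableSet_Icc

lemma kcons_mem (n : ℕ) (R t : ℝ) (x : Fin n → ℝ) :
    (Fin.cons t x : Fin (n+1) → ℝ) ∈ kcube (n+1) R ↔ t ∈ Set.Icc (-R) R ∧ x ∈ kcube n R := by
  simp only [kcube, Set.mem_Icc, Pi.le_def, Fin.forall_fin_succ, Fin.cons_zero, Fin.cons_succ]
  tauto

lemma kcons_mp (n : ℕ) : MeasurePreserving
    (fun q : ℝ × (Fin n → ℝ) => (Fin.cons q.1 q.2 : Fin (n+1) → ℝ)) := by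
  have h := (volume_preserving_piFinSuccAbove (fun _ : Fin (n+1) => ℝ) 0).symm
  convert h using 1
  ext q i
  simp [MeasurableEquiv.piFinSuccAbove, Fin.insertNthEquiv, Fin.insertNth_zero']

lemma kcons_emb (n : ℕ) : MeasurableEmbedding
    (fun q : ℝ × (Fin n → ℝ) => (Fin.cons q.1 q.2 : Fin (n+1) → ℝ)) := by
  have h := (MeasurableEquiv.piFinSuccAbove (fun _ : Fin (n+1) => ℝ) 0).symm.measurableEmbedding
  convert h using 1
  ext q i
  simp [MeasurableEquiv.piFinSuccAbove, Fin.insertNthEquiv, Fin.insertNth_zero']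

lemma kcons_mp_restrict (n : ℕ) (R : ℝ) : MeasurePreserving
    (fun q : ℝ × (Fin n → ℝ) => (Fin.cons q.1 q.2 : Fin (n+1) → ℝ))
    ((volume.restrict (Set.Icc (-R) R)).prod (volume.restrict (kcube n R)))
    (volume.restrict (kcube (n+1) R)) := by
  have h := (kcons_mp n).restrict_preimage (kcube_meas (n+1) R)
  have e : (fun q : ℝ × (Fin n → ℝ) => (Fin.cons q.1 q.2 : Fin (n+1) → ℝ)) ⁻¹' kcube (n+1) R
      = Set.Icc (-R) R ×ˢ kcube n R := by
    ext ⟨t, x⟩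
    exact kcons_mem n R t x
  rw [e] at h
  rw [Measure.prod_restrict]
  exact h

lemma kcons_meas (n : ℕ) : Measurable
    (fun q : ℝ × (Fin n → ℝ) => (Fin.cons q.1 q.2 : Fin (n+1) → ℝ)) :=
  (kcons_mp n).measurable

lemma kcons_cont (n : ℕ) : Continuous
    (fun q : ℝ × (Fin n → ℝ) => (Fin.cons q.1 q.2 : Fin (n+1) → ℝ)) := by
  apply continuous_pi
  intro i
  refine Fin.cases ?_ ?_ i
  · simpa using continuous_fst
  · intro j
    simp only [Fin.cons_succ]
    exact (continuous_apply j).comp continuous_snd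

lemma klintegral_cons (n : ℕ) (R : ℝ) (φ : (Fin (n+1) → ℝ) → ENNReal) (hφ : Measurable φ) :
    ∫⁻ x in kcube (n+1) R, φ x =
      ∫⁻ t in Set.Icc (-R) R, ∫⁻ x in kcube n R, φ (Fin.cons t x) := by
  rw [← (kcons_mp_restrict n R).lintegral_comp hφ, lintegral_prod]
  exact (hφ.comp (kcons_meas n)).aemeasurable

lemma kintegral_cons (n : ℕ) (R : ℝ) (φ : (Fin (n+1) → ℝ) → ℝ) (hφ : Continuous φ) :
    ∫ x in kcube (n+1) R, φ x =
      ∫ t in Set.Icc (-R) R, ∫ x in kcube n R, φ (Fin.cons t x) := by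
  rw [← (kcons_mp_restrict n R).integral_comp (kcons_emb n), integral_prod]
  have h1 : Integrable φ (volume.restrict (kcube (n+1) R)) :=
    hφ.continuousOn.integrableOn_compact (kcube_compact _ _)
  exact (kcons_mp_restrict n R).integrable_comp_of_integrable h1

lemma kmarg_cont (n : ℕ) (R : ℝ) (φ : (Fin (n+1) → ℝ) → ℝ) (hφ : Continuous φ) :
    Continuous (fun t => ∫ x in kcube n R, φ (Fin.cons t x)) :=
  continuous_parametric_integral_of_continuous
    (f := fun t x => φ (Fin.cons t x)) (hφ.comp (kcons_cont n)) (kcube_compact n R)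

lemma kcube_vol_pos (n : ℕ) (R : ℝ) (hR : 0 < R) : 0 < volume (kcube n R) := by
  rw [kcube, Real.volume_Icc_pi]
  apply pos_iff_ne_zero.2
  rw [Finset.prod_ne_zero_iff]
  intro i _
  simp; linarith

lemma kint_pos (n : ℕ) (R : ℝ) (hR : 0 < R) (φ : (Fin n → ℝ) → ℝ) (hφ : Continuous φ)
    (h : ∀ x, 0 < φ x) : 0 < ∫ x in kcube n R, φ x := by
  rw [setIntegral_pos_iff_support_of_nonneg_ae]
  · have : Function.support φ = Set.univ := by
      ext x; simp [(h x).ne']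
    rw [this, Set.univ_inter]
    exact kcube_vol_pos n R hR
  · exact Filter.Eventually.of_forall fun x => (h x).le
  · exact hφ.continuousOn.integrableOn_compact (kcube_compact _ _)

lemma kint_pos' (n : ℕ) (R : ℝ) (φ : (Fin n → ℝ) → ℝ) (hφ : Continuous φ)
    (h : ∀ x, 0 ≤ φ x) (hs : ∀ x, x ∉ kcube n R → φ x = 0) (x : Fin n → ℝ) (hx : 0 < φ x) :
    0 < ∫ x in kcube n R, φ x := by
  rw [setIntegral_pos_iff_support_of_nonneg_ae]
  · have : Function.support φ ⊆ kcube n R := by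
      intro x hx
      by_contra h
      exact hx (hs x h)
    rw [Set.inter_eq_left.2 this]
    exact (hφ.isOpen_support).measure_pos _ ⟨x, hx.ne'⟩
  · exact Filter.Eventually.of_forall h
  · exact hφ.continuousOn.integrableOn_compact (kcube_compact _ _)

lemma kint_zero (n : ℕ) (R : ℝ) (φ : (Fin n → ℝ) → ℝ) (hφ : Continuous φ)
    (h : ∀ x, 0 ≤ φ x) (hs : ∀ x, x ∉ kcube n R → φ x = 0)
    (h0 : ¬ 0 < ∫ x in kcube n R, φ x) (x : Fin n → ℝ) : φ x = 0 := by
  by_contra hne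
  exact h0 (kint_pos' n R φ hφ h hs x (lt_of_le_of_ne (h x) (Ne.symm hne)))

theorem knothe_exists (L R : ℝ) (hL : 0 < L) (hR : 0 < R) (n : ℕ) :
    ∀ (A : Type) [MeasurableSpace A] (f g : A → (Fin n → ℝ) → ℝ),
      Measurable (Function.uncurry f) → Measurable (Function.uncurry g) →
      (∀ a, Continuous (f a)) → (∀ a, Continuous (g a)) → (∀ a x, 0 ≤ f a x) →
      (∀ a x, x ∉ kcube n L → f a x = 0) → (∀ a y, 0 < g a y) →
      ∃ (T : A → (Fin n → ℝ) → (Fin n → ℝ)) (d : A → (Fin n → ℝ) → (Fin n → ℝ)),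
        Measurable (Function.uncurry T) ∧ Measurable (Function.uncurry d) ∧
        (∀ a x k, T a x k ∈ Set.Icc (-R) R) ∧ (∀ a x k, 0 ≤ d a x k) ∧
        (∀ a x, 0 < f a x → g a (T a x) * (∏ k, d a x k) * (∫ x in kcube n L, f a x) =
          f a x * ∫ y in kcube n R, g a y) ∧
        (∀ a x k, (∀ t, f a (Function.update x k t) = 0) ∨
          ∀ t, HasDerivAt (fun s => T a (Function.update x k s) k)
            (d a (Function.update x k t) k) t) ∧
        (∀ a, ∀ φ : (Fin n → ℝ) → ENNReal, Measurable φ →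
          ENNReal.ofReal (∫ y in kcube n R, g a y) *
            ∫⁻ x in kcube n L, ENNReal.ofReal (f a x) * φ (T a x) =
          ENNReal.ofReal (∫ x in kcube n L, f a x) *
            ∫⁻ y in kcube n R, ENNReal.ofReal (g a y) * φ y) := by
  induction n with
  | zero =>
    intro A _ f g hfm hgm hfc hgc hf0 hfs hg
    have hu : ∀ (R : ℝ), kcube 0 R = Set.univ := by
      intro R; ext x; simp [kcube, Subsingleton.elim x (fun _ => -R),
        Subsingleton.elim (fun _ => -R) (fun _ : Fin 0 => R)]
    have hv : (volume : Measure (Fin 0 → ℝ)) = Measure.dirac default :=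
      Measure.volume_pi_eq_dirac _
    refine ⟨fun _ x => x, fun _ x => x, measurable_snd, measurable_snd,
      fun _ _ k => k.elim0, fun _ _ k => k.elim0, ?_, fun _ _ k => k.elim0, ?_⟩
    · intro a x hx
      rw [hu, hu, hv, Measure.restrict_univ, integral_dirac, integral_dirac,
        Subsingleton.elim x default]
      simp [mul_comm]
    · intro a φ hφ
      rw [hu, hu, hv, Measure.restrict_univ, integral_dirac, integral_dirac,
        lintegral_dirac, lintegral_dirac]
      ring
  | succ n ih =>
    intro A _ f g hfm hgm hfc hgc hf0 hfs hg
    set f1 : A → ℝ → ℝ := fun a t => ∫ x in kcube n L, f a (Fin.cons t x) with hf1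
    set g1 : A → ℝ → ℝ := fun a t => ∫ x in kcube n R, g a (Fin.cons t x) with hg1
    have hconsA : Measurable (fun q : (A × ℝ) × (Fin n → ℝ) =>
        (q.1.1, (Fin.cons q.1.2 q.2 : Fin (n+1) → ℝ))) := by
      apply (measurable_fst.comp measurable_fst).prodMk
      exact (kcons_meas n).comp ((measurable_snd.comp measurable_fst).prodMk measurable_snd)
    have hf1m : Measurable (Function.uncurry f1) :=
      (StronglyMeasurable.integral_prod_right (ν := volume.restrict (kcube n L))
        (f := fun (q : A × ℝ) x => f q.1 (Fin.cons q.2 x))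
        (hfm.comp hconsA).stronglyMeasurable).measurable
    have hg1m : Measurable (Function.uncurry g1) :=
      (StronglyMeasurable.integral_prod_right (ν := volume.restrict (kcube n R))
        (f := fun (q : A × ℝ) x => g q.1 (Fin.cons q.2 x))
        (hgm.comp hconsA).stronglyMeasurable).measurable
    have hf1c : ∀ a, Continuous (f1 a) := fun a => kmarg_cont n L (f a) (hfc a)
    have hg1c : ∀ a, Continuous (g1 a) := fun a => kmarg_cont n R (g a) (hgc a)
    have hf10 : ∀ a t, 0 ≤ f1 a t := fun a t => integral_nonneg fun x => hf0 a _
    have hf1s : ∀ a t, t ∉ Set.Icc (-L) L → f1 a t = 0 := by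
      intro a t ht
      simp only [hf1]
      apply integral_eq_zero_of_ae
      refine Filter.Eventually.of_forall fun x => ?_
      apply hfs
      rw [kcons_mem]
      exact fun h => ht h.1
    have hconsc : ∀ t : ℝ, Continuous (fun x : Fin n → ℝ => (Fin.cons t x : Fin (n+1) → ℝ)) :=
      fun t => (kcons_cont n).comp (continuous_const.prodMk continuous_id)
    have hg1p : ∀ a t, 0 < g1 a t := fun a t =>
      kint_pos n R hR _ ((hgc a).comp (hconsc t)) fun x => hg a _
    obtain ⟨T1, hT1m, hT1R, hT1⟩ := knothe_one L R hL hR f1 g1 hf1m hg1m hf1c hg1c hf10 hf1s hg1p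
    have hcc : ∀ a, ∫ x in kcube (n+1) L, f a x = ∫ t in Set.Icc (-L) L, f1 a t :=
      fun a => kintegral_cons n L (f a) (hfc a)
    have hmm : ∀ a, ∫ x in kcube (n+1) R, g a x = ∫ t in Set.Icc (-R) R, g1 a t :=
      fun a => kintegral_cons n R (g a) (hgc a)
    have hcm : Measurable (fun a => ∫ t in Set.Icc (-L) L, f1 a t) :=
      (StronglyMeasurable.integral_prod_right hf1m.stronglyMeasurable).measurable
    have hmmeas : Measurable (fun a => ∫ t in Set.Icc (-R) R, g1 a t) :=
      (StronglyMeasurable.integral_prod_right hg1m.stronglyMeasurable).measurable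
    have hgT : Measurable (fun q : A × ℝ => g1 q.1 (T1 q.1 q.2)) :=
      hg1m.comp (measurable_fst.prodMk hT1m)
    let f' : A × ℝ → (Fin n → ℝ) → ℝ := fun q x => f q.1 (Fin.cons q.2 x)
    let g' : A × ℝ → (Fin n → ℝ) → ℝ := fun q x => g q.1 (Fin.cons (T1 q.1 q.2) x)
    have hf'm : Measurable (Function.uncurry f') := hfm.comp hconsA
    have hg'm : Measurable (Function.uncurry g') := by
      have : Measurable (fun q : (A × ℝ) × (Fin n → ℝ) =>
          (q.1.1, (Fin.cons (T1 q.1.1 q.1.2) q.2 : Fin (n+1) → ℝ))) := by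
        apply (measurable_fst.comp measurable_fst).prodMk
        exact (kcons_meas n).comp ((hT1m.comp measurable_fst).prodMk measurable_snd)
      exact hgm.comp this
    have hf's : ∀ q x, x ∉ kcube n L → f' q x = 0 := by
      intro q x hx
      apply hfs
      rw [kcons_mem]
      exact fun h => hx h.2
    obtain ⟨T', d', hT'm, hd'm, hT'R, hd'0, hJ, hline, hpush⟩ := ih (A × ℝ) f' g' hf'm hg'm
      (fun q => (hfc _).comp (hconsc _)) (fun q => (hgc _).comp (hconsc _)) (fun q x => hf0 _ _)
      hf's (fun q x => hg _ _)
    let d1 : A → ℝ → ℝ := fun a t => f1 a t * (∫ y in Set.Icc (-R) R, g1 a y) /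
          (g1 a (T1 a t) * ∫ x in Set.Icc (-L) L, f1 a x)
    have hd1m : Measurable (Function.uncurry d1) :=
      (hf1m.mul (hmmeas.comp measurable_fst)).div (hgT.mul (hcm.comp measurable_fst))
    have hsplit : Measurable (fun q : A × (Fin (n+1) → ℝ) => ((q.1, q.2 0), Fin.tail q.2)) := by
      refine (measurable_fst.prodMk ((measurable_pi_apply 0).comp measurable_snd)).prodMk ?_
      rw [measurable_pi_iff]
      intro i
      exact (measurable_pi_apply i.succ).comp measurable_snd
    have hsplit0 : Measurable (fun q : A × (Fin (n+1) → ℝ) => (q.1, q.2 0)) :=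
      measurable_fst.comp hsplit
    refine ⟨fun a x => Fin.cons (T1 a (x 0)) (T' (a, x 0) (Fin.tail x)),
      fun a x => Fin.cons (d1 a (x 0)) (d' (a, x 0) (Fin.tail x)), ?_, ?_, ?_, ?_, ?_, ?_, ?_⟩
    · exact (kcons_meas n).comp ((hT1m.comp hsplit0).prodMk (hT'm.comp hsplit))
    · exact (kcons_meas n).comp ((hd1m.comp hsplit0).prodMk (hd'm.comp hsplit))
    · intro a x k
      refine Fin.cases ?_ ?_ k
      · exact hT1R a _
      · intro j; exact hT'R _ _ j
    · intro a x k
      refine Fin.cases ?_ ?_ k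
      · simp only [Fin.cons_zero]
        have h1 := hf10 a (x 0)
        have h2 := (hg1p a (T1 a (x 0))).le
        have h3 : 0 ≤ ∫ x in Set.Icc (-L) L, f1 a x := integral_nonneg fun t => hf10 a t
        have h4 : 0 ≤ ∫ x in Set.Icc (-R) R, g1 a x := integral_nonneg fun t => (hg1p a t).le
        simp only [d1]
        positivity
      · intro j; exact hd'0 _ _ j
    · intro a x hx
      have hxe : (Fin.cons (x 0) (Fin.tail x) : Fin (n+1) → ℝ) = x := Fin.cons_self_tail x
      have hpos' : 0 < f' (a, x 0) (Fin.tail x) := by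
        simp only [f', hxe]; exact hx
      have hf1pos : 0 < f1 a (x 0) :=
        kint_pos' n L (f' (a, x 0)) ((hfc _).comp (hconsc _)) (fun x => hf0 _ _)
          (hf's _) _ hpos'
      have hcpos := kint_pos' (n+1) L (f a) (hfc a) (hf0 a) (hfs a) x hx
      have h1 := hJ (a, x 0) (Fin.tail x) hpos'
      rw [hcc] at hcpos ⊢
      rw [hmm]
      have hg1pos := hg1p a (T1 a (x 0))
      simp only [Fin.prod_univ_succ, Fin.cons_zero, Fin.cons_succ]
      have e1 : ∫ z in kcube n L, f' (a, x 0) z = f1 a (x 0) := rfl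
      have e2 : ∫ z in kcube n R, g' (a, x 0) z = g1 a (T1 a (x 0)) := rfl
      have e3 : f' (a, x 0) (Fin.tail x) = f a x := by simp only [f', hxe]
      rw [e1, e2, e3] at h1
      change g a (Fin.cons (T1 a (x 0)) (T' (a, x 0) (Fin.tail x))) * _ * _ = _ at h1
      change g a (Fin.cons (T1 a (x 0)) (T' (a, x 0) (Fin.tail x))) * _ * _ = _
      set gg := g a (Fin.cons (T1 a (x 0)) (T' (a, x 0) (Fin.tail x)))
      set P := ∏ i, d' (a, x 0) (Fin.tail x) i
      have hd1e : d1 a (x 0) = f1 a (x 0) * (∫ y in Set.Icc (-R) R, g1 a y) /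
          (g1 a (T1 a (x 0)) * ∫ x in Set.Icc (-L) L, f1 a x) := rfl
      rw [hd1e]
      set M := ∫ y in Set.Icc (-R) R, g1 a y
      set C := ∫ x in Set.Icc (-L) L, f1 a x
      have : gg * (f1 a (x 0) * M / (g1 a (T1 a (x 0)) * C) * P) * C =
          (gg * P * f1 a (x 0)) * M / g1 a (T1 a (x 0)) := by
        field_simp
      rw [this, h1]
      field_simp
    · intro a x k
      refine Fin.cases ?_ ?_ k
      · by_cases hc0 : 0 < ∫ x in kcube (n+1) L, f a x
        · right
          intro t
          rw [hcc] at hc0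
          have := (hT1 a hc0).1 t
          simpa [d1] using this
        · left
          intro t
          exact kint_zero (n+1) L (f a) (hfc a) (hf0 a) (hfs a) hc0 _
      · intro j
        have hup : ∀ t, Function.update x j.succ t =
            Fin.cons (x 0) (Function.update (Fin.tail x) j t) := by
          intro t
          rw [Fin.cons_update, Fin.cons_self_tail]
        rcases hline (a, x 0) (Fin.tail x) j with h | h
        · left
          intro t
          rw [hup]
          exact h t
        · right
          intro t
          simp only [hup, Fin.cons_zero, Fin.cons_succ, Fin.tail_cons]
          exact h t
    · intro a φ hφ
      by_cases hc0 : 0 < ∫ x in kcube (n+1) L, f a x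
      swap
      · have hz := kint_zero (n+1) L (f a) (hfc a) (hf0 a) (hfs a) hc0
        simp [hz]
      · rw [hcc] at hc0 ⊢
        rw [hmm]
        have hTam : Measurable (fun x : Fin (n+1) → ℝ =>
            (Fin.cons (T1 a (x 0)) (T' (a, x 0) (Fin.tail x)) : Fin (n+1) → ℝ)) := by
          have := ((kcons_meas n).comp ((hT1m.comp hsplit0).prodMk (hT'm.comp hsplit)))
          exact this.comp (measurable_const.prodMk measurable_id)
        rw [klintegral_cons n L (fun x => ENNReal.ofReal (f a x) *
            φ (Fin.cons (T1 a (x 0)) (T' (a, x 0) (Fin.tail x))))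
            (((hfc a).measurable.ennreal_ofReal).mul (hφ.comp hTam)),
          klintegral_cons n R (fun y => ENNReal.ofReal (g a y) * φ y)
            (((hgc a).measurable.ennreal_ofReal).mul hφ)]
        set Φ : ℝ → ENNReal := fun y => ∫⁻ x in kcube n R,
          ENNReal.ofReal (g a (Fin.cons y x)) * φ (Fin.cons y x) with hΦ
        have hgne : ∀ y, ENNReal.ofReal (g1 a y) ≠ 0 := fun y => by
          simpa using hg1p a y
        have hinner : ∀ t, ∫⁻ x in kcube n L, ENNReal.ofReal (f a (Fin.cons t x)) *
            φ (Fin.cons (T1 a ((Fin.cons t x : Fin (n+1) → ℝ) 0))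
              (T' (a, (Fin.cons t x : Fin (n+1) → ℝ) 0)
                (Fin.tail (Fin.cons t x : Fin (n+1) → ℝ)))) =
            ENNReal.ofReal (f1 a t) * (Φ (T1 a t) / ENNReal.ofReal (g1 a (T1 a t))) := by
          intro t
          simp only [Fin.cons_zero, Fin.tail_cons]
          have := hpush (a, t) (fun y => φ (Fin.cons (T1 a t) y))
            (hφ.comp (hconsc _).measurable)
          change ENNReal.ofReal (g1 a (T1 a t)) * _ = ENNReal.ofReal (f1 a t) * Φ (T1 a t) at this
          rw [← mul_div_assoc, ← this, mul_comm (ENNReal.ofReal (g1 a (T1 a t))),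
            ENNReal.mul_div_cancel_right (hgne _) ENNReal.ofReal_ne_top]
        simp_rw [hinner]
        rw [(hT1 a hc0).2 (fun y => Φ y / ENNReal.ofReal (g1 a y))]
        congr 1
        apply lintegral_congr
        intro y
        rw [ENNReal.mul_div_cancel (hgne _) ENNReal.ofReal_ne_top]

lemma kibp_one (ψ ψ' τ δ : ℝ → ℝ) (hψc : Continuous ψ) (hψ'c : Continuous ψ')
    (hcs : HasCompactSupport ψ) (hcs' : HasCompactSupport ψ') (hψ0 : ∀ x, 0 ≤ ψ x)
    (hd : ∀ t, HasDerivAt ψ (ψ' t) t) (hδ : ∀ t, 0 ≤ δ t)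
    (hline : (∀ t, ψ t = 0) ∨ ∀ t, HasDerivAt τ (δ t) t) :
    ∫⁻ t, ENNReal.ofReal (ψ t * δ t) = ENNReal.ofReal (∫ t, -(ψ' t * τ t)) ∧
      0 ≤ ∫ t, -(ψ' t * τ t) := by
  rcases hline with h0 | hτ
  · have h0' : ψ = fun _ => 0 := funext h0
    have h1 : ∀ t, ψ' t = 0 := by
      intro t
      have := hd t
      rw [h0'] at this
      exact this.unique (hasDerivAt_const t 0)
    simp [h0, h1]
  · have hτc : Continuous τ := continuous_iff_continuousAt.2 fun x => (hτ x).continuousAt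
    have hloc : LocallyIntegrable δ := by
      rw [locallyIntegrable_iff]
      intro K hK
      obtain ⟨r, hr⟩ := hK.isBounded.subset_closedBall 0
      rw [Real.closedBall_eq_Icc] at hr
      have h1 : IntegrableOn δ (Set.Icc (0 - r) (0 + r)) := by
        rw [integrableOn_Icc_iff_integrableOn_Ioc]
        exact intervalIntegral.integrableOn_deriv_of_nonneg hτc.continuousOn
          (fun x _ => hτ x) (fun x _ => hδ x)
      exact h1.mono_set hr
    have hi1 : Integrable (ψ * δ) :=
      hloc.integrable_smul_left_of_hasCompactSupport hψc hcs
    have hi2 : Integrable (ψ' * τ) :=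
      (hψ'c.mul hτc).integrable_of_hasCompactSupport hcs'.mul_right
    have hi3 : Integrable (ψ * τ) :=
      (hψc.mul hτc).integrable_of_hasCompactSupport hcs.mul_right
    have key := integral_mul_deriv_eq_deriv_mul_of_integrable (fun x _ => hd x) (fun x _ => hτ x)
      hi1 hi2 hi3
    have h0 : ∀ t, 0 ≤ ψ t * δ t := fun t => mul_nonneg (hψ0 t) (hδ t)
    rw [integral_neg, ← key]
    refine ⟨?_, integral_nonneg h0⟩
    exact (ofReal_integral_eq_lintegral_ofReal hi1 (Filter.Eventually.of_forall h0)).symm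

lemma kibp (n : ℕ) (k : Fin n) (R : ℝ) (ψ ψ' τ δ : (Fin n → ℝ) → ℝ)
    (hψc : Continuous ψ) (hψ'c : Continuous ψ')
    (hcs : HasCompactSupport ψ) (hcs' : HasCompactSupport ψ') (hψ0 : ∀ x, 0 ≤ ψ x)
    (hd : ∀ x t, HasDerivAt (fun s => ψ (Function.update x k s)) (ψ' (Function.update x k t)) t)
    (hτm : Measurable τ) (hδm : Measurable δ)
    (hδ : ∀ t, 0 ≤ δ t) (hτR : ∀ x, |τ x| ≤ R)
    (hline : ∀ x, (∀ t, ψ (Function.update x k t) = 0) ∨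
      ∀ t, HasDerivAt (fun s => τ (Function.update x k s)) (δ (Function.update x k t)) t) :
    ∫⁻ x, ENNReal.ofReal (ψ x * δ x) = ENNReal.ofReal (∫ x, -(ψ' x * τ x)) ∧
      0 ≤ ∫ x, -(ψ' x * τ x) ∧ Integrable (fun x => -(ψ' x * τ x)) := by
  obtain ⟨n, rfl⟩ : ∃ m, n = m + 1 := ⟨n - 1, by have := k.2; omega⟩
  set e := (MeasurableEquiv.piFinSuccAbove (fun _ : Fin (n+1) => ℝ) k).symm with he
  have hmp : MeasurePreserving e :=
    (volume_preserving_piFinSuccAbove (fun _ : Fin (n+1) => ℝ) k).symm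
  have hev : ∀ t x, e (t, x) = k.insertNth t x := fun t x => rfl
  have hup : ∀ x t, e (t, x) = Function.update (k.insertNth (0:ℝ) x : Fin (n+1) → ℝ) k t := by
    intro x t
    rw [hev, Fin.update_insertNth]
  have hintg : Integrable (fun x => -(ψ' x * τ x)) := by
    have h1 : Integrable ψ' := hψ'c.integrable_of_hasCompactSupport hcs'
    exact (h1.mul_bdd (c := R) hτm.aestronglyMeasurable (Filter.Eventually.of_forall hτR)).neg
  have hclos : ∀ x : Fin n → ℝ, Topology.IsClosedEmbedding
      (fun t : ℝ => Function.update (k.insertNth (0:ℝ) x : Fin (n+1) → ℝ) k t) := by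
    intro x
    have hc : Continuous (fun t : ℝ => Function.update (k.insertNth (0:ℝ) x : Fin (n+1) → ℝ) k t) :=
      continuous_const.update k continuous_id
    have hli : Function.LeftInverse (fun y : Fin (n+1) → ℝ => y k)
      (fun t : ℝ => Function.update (k.insertNth (0:ℝ) x : Fin (n+1) → ℝ) k t) := by
        intro t; simp
    exact hli.isClosedEmbedding (continuous_apply k) hc
  have h1 : ∀ x : Fin n → ℝ,
      ∫⁻ t, ENNReal.ofReal (ψ (e (t, x)) * δ (e (t, x))) =
        ENNReal.ofReal (∫ t, -(ψ' (e (t, x)) * τ (e (t, x)))) ∧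
      0 ≤ ∫ t, -(ψ' (e (t, x)) * τ (e (t, x))) := by
    intro x
    have hc := (hclos x)
    simp only [hup]
    exact kibp_one _ _ _ _ (hψc.comp hc.continuous) (hψ'c.comp hc.continuous)
      (hcs.comp_isClosedEmbedding hc) (hcs'.comp_isClosedEmbedding hc) (fun t => hψ0 _)
      (hd _) (fun t => hδ _) (hline _)
  have hintg2 : Integrable (fun q : ℝ × (Fin n → ℝ) => -(ψ' (e q) * τ (e q)))
      (volume.prod volume) :=
    hmp.integrable_comp_of_integrable hintg
  have e2 : ∫ x, -(ψ' x * τ x) = ∫ x : Fin n → ℝ, ∫ t : ℝ, -(ψ' (e (t, x)) * τ (e (t, x))) := by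
    rw [← hmp.integral_comp e.measurableEmbedding]
    exact integral_prod_symm _ hintg2
  refine ⟨?_, ?_, hintg⟩
  · have e1 : ∫⁻ x, ENNReal.ofReal (ψ x * δ x) =
        ∫⁻ x : Fin n → ℝ, ∫⁻ t : ℝ, ENNReal.ofReal (ψ (e (t, x)) * δ (e (t, x))) := by
      have hm : Measurable (fun x => ENNReal.ofReal (ψ x * δ x)) :=
        (hψc.measurable.mul hδm).ennreal_ofReal
      rw [← hmp.lintegral_comp hm]
      exact lintegral_prod_symm _ (hm.comp e.measurable).aemeasurable
    rw [e1, e2, ofReal_integral_eq_lintegral_ofReal hintg2.integral_prod_right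
      (Filter.Eventually.of_forall fun x => (h1 x).2)]
    exact lintegral_congr fun x => (h1 x).1
  · rw [e2]
    exact integral_nonneg fun x => (h1 x).2

lemma kamgm (n : ℕ) (hn : 0 < n) (d : Fin n → ℝ) (hd : ∀ k, 0 ≤ d k) :
    (∏ k, d k) ^ (1 / (n:ℝ)) ≤ (∑ k, d k) / n := by
  have hn' : (n:ℝ) ≠ 0 := by positivity
  have := Real.geom_mean_le_arith_mean_weighted Finset.univ (fun _ : Fin n => 1 / (n:ℝ)) d
    (fun _ _ => by positivity) (by simp [hn']) (fun k _ => hd k)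
  rw [Real.finsetProd_rpow _ _ (fun k _ => hd k), ← Finset.mul_sum] at this
  linarith [this, show (∑ k, d k) / n = 1 / (n:ℝ) * ∑ k, d k by ring]

lemma kpoint (n : ℕ) (hn : 0 < n) (ps s a f gT c m : ℝ) (d : Fin n → ℝ) (hd : ∀ k, 0 ≤ d k)
    (ha : 0 ≤ a) (hps : 0 < ps) (hs : 0 < s) (hpss : ps - ps / n = s)
    (hf : f = a ^ ps) (hg : 0 < gT) (hc : 0 < c) (hm : 0 < m)
    (hJ : 0 < f → gT * (∏ k, d k) * c = f * m) :
    f * gT ^ (-(1 / (n:ℝ))) ≤ (m / c) ^ (-(1 / (n:ℝ))) / n * (a ^ s * ∑ k, d k) := by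
  have hn' : (0:ℝ) < n := by positivity
  have hsum : 0 ≤ ∑ k, d k := Finset.sum_nonneg fun k _ => hd k
  rcases ha.eq_or_lt with h0 | h0
  · rw [hf, ← h0, Real.zero_rpow hps.ne', Real.zero_rpow hs.ne']; simp
  · have hfp : 0 < f := by rw [hf]; positivity
    have hJ' := hJ hfp
    have hP0 : 0 ≤ ∏ k, d k := Finset.prod_nonneg fun k _ => hd k
    have hP : 0 < ∏ k, d k := by
      rcases hP0.eq_or_lt with h | h
      · rw [← h] at hJ'
        have : 0 < f * m := by positivity
        simp at hJ'
        rcases hJ' with h | h <;> linarith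
      · exact h
    have hgT : gT = f * (m / c) * (∏ k, d k)⁻¹ := by
      field_simp; linarith
    have e1 : gT ^ (-(1 / (n:ℝ))) =
        f ^ (-(1 / (n:ℝ))) * (m / c) ^ (-(1 / (n:ℝ))) * (∏ k, d k) ^ (1 / (n:ℝ)) := by
      rw [hgT, Real.mul_rpow (by positivity) (by positivity),
        Real.mul_rpow (by positivity) (by positivity), Real.inv_rpow hP0, Real.rpow_neg hP0,
        inv_inv]
    have e2 : f * f ^ (-(1 / (n:ℝ))) = a ^ s := by
      rw [hf, ← Real.rpow_mul ha, ← Real.rpow_add h0]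
      congr 1
      rw [← hpss]; ring
    have h3 := kamgm n hn d hd
    calc f * gT ^ (-(1 / (n:ℝ)))
        = a ^ s * (m / c) ^ (-(1 / (n:ℝ))) * (∏ k, d k) ^ (1 / (n:ℝ)) := by
          rw [e1, ← e2]; ring
      _ ≤ a ^ s * (m / c) ^ (-(1 / (n:ℝ))) * ((∑ k, d k) / n) := by gcongr
      _ = _ := by ring

lemma kfinal_algebra (n p q s c m I1 J W : ℝ) (hn : 0 < n) (hc : 0 < c) (hm : 0 < m)
    (hq : 1 / p + 1 / q = 1) (hJ : 0 ≤ J)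
    (h : c * I1 ≤ m * ((m / c) ^ (-(1 / n)) / n) * (s * (W * (c / m * J) ^ (1 / q)))) :
    c ^ (1 / p - 1 / n) * I1 ≤ m ^ (1 / p - 1 / n) * (s / n * J ^ (1 / q) * W) := by
  have e1 : (m / c) ^ (-(1 / n)) = m ^ (-(1 / n)) * c ^ (1 / n) := by
    rw [Real.div_rpow hm.le hc.le, Real.rpow_neg hc.le, div_inv_eq_mul]
  have e2 : (c / m * J) ^ (1 / q) = c ^ (1 / q) * m ^ (-(1 / q)) * J ^ (1 / q) := by
    rw [Real.mul_rpow (by positivity) hJ, Real.div_rpow hc.le hm.le, Real.rpow_neg hm.le,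
      div_eq_mul_inv]
  have e3 : c = c ^ (1 / p - 1 / n) * (c ^ (1 / n) * c ^ (1 / q)) := by
    rw [← Real.rpow_add hc, ← Real.rpow_add hc,
      show 1 / p - 1 / n + (1 / n + 1 / q) = 1 by linarith, Real.rpow_one]
  have e4 : m * (m ^ (-(1 / n)) * m ^ (-(1 / q))) = m ^ (1 / p - 1 / n) := by
    nth_rewrite 1 [← Real.rpow_one m]
    rw [← Real.rpow_add hm, ← Real.rpow_add hm]
    congr 1; linarith
  have hpos : 0 < c ^ (1 / n) * c ^ (1 / q) := by positivity
  refine le_of_mul_le_mul_right ?_ hpos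
  calc _ = c * I1 := by nth_rewrite 4 [e3]; ring
    _ ≤ _ := h
    _ = _ := by rw [e1, e2, ← e4]; ring

theorem kmain (n : ℕ) (hn : 2 ≤ n) (p : ℝ) (hp1 : 1 < p) (hpn : p < (n : ℝ))
    (u : EuclideanSpace ℝ (Fin n) → ℝ) (hu : ContDiff ℝ 1 u) (hus : HasCompactSupport u)
    (g : (Fin n → ℝ) → ℝ) (hgc : Continuous g) (hg : ∀ y, 0 < g y) (R : ℝ) (hR : 0 < R) :
    (∫ x : Fin n → ℝ, |u (WithLp.toLp 2 x)| ^ (p * n / ((n : ℝ) - p))) ^ (1 / p - 1 / (n:ℝ)) *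
        (∫ y in kcube n R, g y ^ (1 - 1 / (n:ℝ))) ≤
      (∫ y in kcube n R, g y) ^ (1 / p - 1 / (n:ℝ)) *
        (p * (n - 1) / (n - p) / n *
          (∫ y in kcube n R, g y * ‖WithLp.toLp 2 y‖ ^ (p / (p - 1))) ^ (1 / (p / (p - 1))) *
          (∫ x : Fin n → ℝ, ‖gradient u (WithLp.toLp 2 x)‖ ^ p) ^ (1 / p)) := by
  have hn0 : 0 < n := by omega
  have hnr : (2:ℝ) ≤ n := by exact_mod_cast hn
  have hnp : 0 < (n:ℝ) - p := by linarith
  set q := p / (p - 1) with hq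
  set s := p * (n - 1) / (n - p) with hs
  set ps := p * n / ((n : ℝ) - p) with hps
  have hp1' : 0 < p - 1 := by linarith
  have hqpos : 0 < q := by rw [hq]; apply div_pos <;> linarith
  have hpq : 1 / p + 1 / q = 1 := by rw [hq]; field_simp; ring
  have hpsp : 0 < ps := by rw [hps]; apply div_pos <;> [apply mul_pos; skip] <;> linarith
  have hs1 : 1 < s := by
    rw [hs, lt_div_iff₀ hnp]; nlinarith
  have hpss : ps - ps / n = s := by
    rw [hps, hs]; field_simp
  have hsq : (s - 1) * q = ps := by
    rw [hps, hs, hq]; field_simp; ring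
  have hPQ : p.HolderConjugate q := by
    rw [Real.holderConjugate_iff]
    refine ⟨hp1, by simpa using hpq⟩
  -- coordinates
  set v : (Fin n → ℝ) → ℝ := fun x => u (WithLp.toLp 2 x) with hv
  let e : (Fin n → ℝ) ≃L[ℝ] EuclideanSpace ℝ (Fin n) :=
    (PiLp.continuousLinearEquiv 2 ℝ (fun _ : Fin n => ℝ)).symm
  have hee : ∀ x, e x = WithLp.toLp 2 x := fun x => rfl
  have hvC : ContDiff ℝ 1 v := hu.comp e.contDiff
  have hvs : HasCompactSupport v := hus.comp_homeomorph e.toHomeomorph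
  have hvc : Continuous v := hvC.continuous
  have hNc : Continuous (fun y : Fin n → ℝ => ‖WithLp.toLp 2 y‖) := e.continuous.norm
  -- support in a cube
  obtain ⟨L, hL, hLs⟩ : ∃ L : ℝ, 0 < L ∧ ∀ x, x ∉ kcube n L → v x = 0 := by
    obtain ⟨r, hr⟩ := hvs.isCompact.isBounded.subset_closedBall 0
    refine ⟨max r 1, by positivity, fun x hx => ?_⟩
    by_contra hne
    apply hx
    have h1 := hr (subset_tsupport v hne)
    rw [mem_closedBall_zero_iff] at h1
    have h2 : ∀ i, |x i| ≤ max r 1 := fun i =>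
      ((norm_le_pi_norm x i).trans h1).trans (le_max_left _ _)
    exact ⟨fun i => (abs_le.1 (h2 i)).1, fun i => (abs_le.1 (h2 i)).2⟩
  set f : (Fin n → ℝ) → ℝ := fun x => |v x| ^ ps with hf
  have hfc : Continuous f := hvc.abs.rpow_const fun x => Or.inr hpsp.le
  have hf0 : ∀ x, 0 ≤ f x := fun x => by positivity
  have hfs : ∀ x, x ∉ kcube n L → f x = 0 := fun x hx => by
    simp [hf, hLs x hx, Real.zero_rpow hpsp.ne']
  have hcset : ∫ x in kcube n L, f x = ∫ x, f x :=
    setIntegral_eq_integral_of_forall_compl_eq_zero hfs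
  set ψ : (Fin n → ℝ) → ℝ := fun x => |v x| ^ s with hψ
  have hψC : ContDiff ℝ 1 ψ := by
    have h1 : ContDiff ℝ 1 (fun x : ℝ => ‖x‖ ^ s) := contDiff_norm_rpow hs1
    exact h1.comp hvC
  have hψs : HasCompactSupport ψ := by
    apply hvs.comp_left (g := fun t => |t| ^ s)
    simp [Real.zero_rpow (by linarith : s ≠ 0)]
  have hDψ : ∀ x w, |fderiv ℝ ψ x w| ≤
      s * (‖gradient u (WithLp.toLp 2 x)‖ * (|v x| ^ (s - 1) * ‖WithLp.toLp 2 w‖)) := by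
    intro x w
    have hv' : HasFDerivAt v ((fderiv ℝ u (e x)).comp (e : (Fin n → ℝ) →L[ℝ] _)) x :=
      ((hu.differentiable one_ne_zero).differentiableAt.hasFDerivAt).comp x e.hasFDerivAt
    have h2 : HasFDerivAt ψ _ x := (hasDerivAt_abs_rpow (v x) hs1).comp_hasFDerivAt x hv'
    rw [h2.fderiv]
    have h3 : |fderiv ℝ u (e x) (e w)| ≤ ‖gradient u (e x)‖ * ‖e w‖ := by
      have : fderiv ℝ u (e x) (e w) = inner ℝ (gradient u (e x)) (e w) := by
        rw [gradient, InnerProductSpace.toDual_symm_apply]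
      rw [this]
      exact abs_real_inner_le_norm _ _
    have h4 : |v x| ^ (s - 2) * |v x| = |v x| ^ (s - 1) := by
      rcases (abs_nonneg (v x)).eq_or_lt with h | h
      · rw [← h, Real.zero_rpow (by linarith : s - 1 ≠ 0)]; simp
      · nth_rewrite 2 [← Real.rpow_one |v x|]
        rw [← Real.rpow_add h]; congr 1; ring
    simp only [smul_apply, ContinuousLinearMap.comp_apply, smul_eq_mul,
      abs_mul, ContinuousLinearEquiv.coe_coe]
    rw [abs_of_pos (by linarith : 0 < s), abs_of_nonneg (by positivity : 0 ≤ |v x| ^ (s - 2)),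
      mul_assoc s, h4]
    have h5 : 0 ≤ |v x| ^ (s - 1) := by positivity
    have := mul_le_mul_of_nonneg_left h3 h5
    rw [← hee, ← hee]
    rw [mul_assoc]
    apply mul_le_mul_of_nonneg_left _ (by linarith)
    linarith [this, show |v x| ^ (s - 1) * (‖gradient u (e x)‖ * ‖e w‖) = ‖gradient u (e x)‖ * (|v x| ^ (s - 1) * ‖e w‖) by ring]
  set c := ∫ x, f x with hc
  set m := ∫ y in kcube n R, g y with hm
  have hmpos : 0 < m := kint_pos n R hR g hgc hg
  have hI1 : 0 ≤ ∫ y in kcube n R, g y ^ (1 - 1 / (n:ℝ)) :=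
    integral_nonneg fun y => by have := (hg y).le; positivity
  have hJ0 : 0 ≤ ∫ y in kcube n R, g y * ‖WithLp.toLp 2 y‖ ^ q :=
    integral_nonneg fun y => by have := (hg y).le; positivity
  have hW0 : 0 ≤ ∫ x : Fin n → ℝ, ‖gradient u (WithLp.toLp 2 x)‖ ^ p :=
    integral_nonneg fun y => by positivity
  have hc0 : 0 ≤ c := integral_nonneg hf0
  rcases hc0.eq_or_lt with hcz | hcpos
  · have hexp : 1 / p - 1 / (n:ℝ) ≠ 0 := by
      have : 1 / (n:ℝ) < 1 / p := one_div_lt_one_div_of_lt (by linarith) hpn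
      linarith
    rw [← hcz, Real.zero_rpow hexp, zero_mul]
    have : 0 < s := by linarith
    positivity
  -- Knothe map
  obtain ⟨T, d, hTm, hdm, hTR, hd0, hJ, hline, hpush⟩ := knothe_exists L R hL hR n Unit
    (fun _ => f) (fun _ => g) (hfc.measurable.comp measurable_snd)
    (hgc.measurable.comp measurable_snd) (fun _ => hfc) (fun _ => hgc) (fun _ => hf0)
    (fun _ => hfs) (fun _ => hg)
  replace hTm : Measurable (T ()) := hTm.comp (measurable_const.prodMk measurable_id)
  replace hdm : Measurable (d ()) := hdm.comp (measurable_const.prodMk measurable_id)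
  replace hTR := hTR ()
  replace hd0 := hd0 ()
  replace hJ := hJ ()
  replace hline := hline ()
  replace hpush := hpush ()
  generalize T () = T at *
  generalize d () = d at *
  simp only [hcset] at hJ hpush
  -- integration by parts
  have hB : ∫⁻ x, ENNReal.ofReal (ψ x * ∑ k, d x k) ≤
      ∫⁻ x, ENNReal.ofReal s * (ENNReal.ofReal ‖gradient u (WithLp.toLp 2 x)‖ *
        ENNReal.ofReal (|v x| ^ (s - 1) * ‖WithLp.toLp 2 (T x)‖)) := by
    have hk := fun k => kibp n k R ψ (fun x => fderiv ℝ ψ x (Pi.single k 1)) (fun x => T x k)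
      (fun x => d x k) hψC.continuous
      ((hψC.continuous_fderiv one_ne_zero).clm_apply continuous_const) hψs
      ((hψs.fderiv ℝ).comp_left (g := fun D : (Fin n → ℝ) →L[ℝ] ℝ => D (Pi.single k 1))
        (by simp))
      (fun x => by positivity)
      (fun x t => by
        have h1 := (hψC.differentiable one_ne_zero).differentiableAt.hasFDerivAt (x := Function.update x k t)
        exact h1.comp_hasDerivAt t (hasDerivAt_update x k t))
      ((measurable_pi_apply k).comp hTm) ((measurable_pi_apply k).comp hdm)
      (fun x => hd0 x k) (fun x => abs_le.2 (hTR x k))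
      (fun x => by
        rcases hline x k with h | h
        · left
          intro t
          have h1 := h t
          simp only [hf] at h1
          rw [Real.rpow_eq_zero (abs_nonneg _) hpsp.ne'] at h1
          simp only [hψ, h1, Real.zero_rpow (by linarith : s ≠ 0)]
        · right; exact h)
    have h1 : ∫⁻ x, ENNReal.ofReal (ψ x * ∑ k, d x k) =
        ∑ k, ∫⁻ x, ENNReal.ofReal (ψ x * d x k) := by
      rw [← lintegral_finsetSum]
      · apply lintegral_congr
        intro x
        rw [Finset.mul_sum, ENNReal.ofReal_sum_of_nonneg]
        intro k _
        exact mul_nonneg (by positivity) (hd0 x k)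
      · intro k _
        exact (hψC.continuous.measurable.mul
          ((measurable_pi_apply k).comp hdm)).ennreal_ofReal
    rw [h1, Finset.sum_congr rfl (fun k _ => (hk k).1),
      ← ENNReal.ofReal_sum_of_nonneg (fun k _ => (hk k).2.1),
      ← integral_finsetSum _ (fun k _ => (hk k).2.2)]
    have h2 : ∀ x, ∑ k, -(fderiv ℝ ψ x (Pi.single k 1) * T x k) = -(fderiv ℝ ψ x (T x)) := by
      intro x
      rw [Finset.sum_neg_distrib]
      congr 1
      have := LinearMap.pi_apply_eq_sum_univ (fderiv ℝ ψ x : (Fin n → ℝ) →ₗ[ℝ] ℝ) (T x)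
      simp only [ContinuousLinearMap.coe_coe, smul_eq_mul] at this
      rw [this]
      apply Finset.sum_congr rfl
      intro k _
      rw [mul_comm]
      congr 2
      ext j
      simp [Pi.single_apply, eq_comm]
    simp_rw [h2]
    have hintg : Integrable (fun x => -(fderiv ℝ ψ x (T x))) := by
      have := integrable_finsetSum Finset.univ (fun k _ => (hk k).2.2)
      simpa only [h2] using this
    calc ENNReal.ofReal (∫ x, -(fderiv ℝ ψ x (T x)))
        ≤ ENNReal.ofReal (∫ x, ‖-(fderiv ℝ ψ x (T x))‖) :=
          ENNReal.ofReal_le_ofReal ((Real.le_norm_self _).trans (norm_integral_le_integral_norm _))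
      _ = ∫⁻ x, ENNReal.ofReal ‖-(fderiv ℝ ψ x (T x))‖ :=
          ofReal_integral_eq_lintegral_ofReal hintg.norm
            (Filter.Eventually.of_forall fun x => norm_nonneg _)
      _ ≤ _ := by
          apply lintegral_mono
          intro x
          simp only
          rw [← ENNReal.ofReal_mul (norm_nonneg _), ← ENNReal.ofReal_mul (by linarith)]
          apply ENNReal.ofReal_le_ofReal
          rw [norm_neg]
          exact hDψ x (T x)
  have hWm : Measurable (fun x : Fin n → ℝ => ‖gradient u (WithLp.toLp 2 x)‖) := by
    have h1 : Continuous (gradient u) := by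
      unfold gradient
      exact (LinearIsometryEquiv.continuous _).comp (hu.continuous_fderiv one_ne_zero)
    exact (h1.comp e.continuous).norm.measurable
  have hVm : Measurable (fun x : Fin n → ℝ => |v x| ^ (s - 1) * ‖WithLp.toLp 2 (T x)‖) :=
    (hvc.abs.rpow_const fun x => Or.inr (by linarith)).measurable.mul (hNc.measurable.comp hTm)
  have hgradc : Continuous (fun x : Fin n → ℝ => ‖gradient u (WithLp.toLp 2 x)‖ ^ p) := by
    have h1 : Continuous (gradient u) := by
      unfold gradient
      exact (LinearIsometryEquiv.continuous _).comp (hu.continuous_fderiv one_ne_zero)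
    exact (h1.comp e.continuous).norm.rpow_const fun x => Or.inr (by linarith)
  have hgrads : HasCompactSupport (fun x : Fin n → ℝ => ‖gradient u (WithLp.toLp 2 x)‖ ^ p) := by
    have h1 : HasCompactSupport (fun x => fderiv ℝ u (e x)) :=
      (hus.fderiv ℝ).comp_homeomorph e.toHomeomorph
    apply h1.comp_left (g := fun D => ‖(InnerProductSpace.toDual ℝ _).symm D‖ ^ p)
    simp [Real.zero_rpow (by linarith : p ≠ 0)]
  have hWi := hgradc.integrable_of_hasCompactSupport (μ := volume) hgrads
  -- Hoelder
  have hHol := ENNReal.lintegral_mul_le_Lp_mul_Lq volume hPQ hWm.ennreal_ofReal.aemeasurable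
    hVm.ennreal_ofReal.aemeasurable
  have hW1 : ∫⁻ x : Fin n → ℝ, ENNReal.ofReal ‖gradient u (WithLp.toLp 2 x)‖ ^ p =
      ENNReal.ofReal (∫ x : Fin n → ℝ, ‖gradient u (WithLp.toLp 2 x)‖ ^ p) := by
    rw [ofReal_integral_eq_lintegral_ofReal hWi
      (Filter.Eventually.of_forall fun x => by positivity)]
    apply lintegral_congr
    intro x
    rw [ENNReal.ofReal_rpow_of_nonneg (norm_nonneg _) (by linarith)]
  have hcont_int : ∀ φ : (Fin n → ℝ) → ℝ, Continuous φ → (∀ x, 0 ≤ φ x) →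
      ∫⁻ y in kcube n R, ENNReal.ofReal (φ y) = ENNReal.ofReal (∫ y in kcube n R, φ y) := by
    intro φ hφ h0
    rw [ofReal_integral_eq_lintegral_ofReal
      (hφ.continuousOn.integrableOn_compact (kcube_compact _ _))
      (Filter.Eventually.of_forall h0)]
  have hV1 : ∫⁻ x : Fin n → ℝ, ENNReal.ofReal (|v x| ^ (s - 1) * ‖WithLp.toLp 2 (T x)‖) ^ q =
      ENNReal.ofReal (c / m * ∫ y in kcube n R, g y * ‖WithLp.toLp 2 y‖ ^ q) := by
    have hNq : Continuous (fun y : Fin n → ℝ => ‖WithLp.toLp 2 y‖ ^ q) :=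
      hNc.rpow_const fun x => Or.inr hqpos.le
    have h1 := hpush (fun y => ENNReal.ofReal (‖WithLp.toLp 2 y‖ ^ q))
      hNq.measurable.ennreal_ofReal
    have h2 : ∫⁻ y in kcube n R, ENNReal.ofReal (g y) * ENNReal.ofReal (‖WithLp.toLp 2 y‖ ^ q)
        = ENNReal.ofReal (∫ y in kcube n R, g y * ‖WithLp.toLp 2 y‖ ^ q) := by
      rw [← hcont_int (fun y => g y * ‖WithLp.toLp 2 y‖ ^ q) (hgc.mul hNq) (fun y => mul_nonneg (hg y).le (by positivity))]
      apply lintegral_congr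
      intro y
      rw [ENNReal.ofReal_mul (hg y).le]
    have h3 : ∫⁻ x in kcube n L, ENNReal.ofReal (f x) *
        ENNReal.ofReal (‖WithLp.toLp 2 (T x)‖ ^ q) =
        ∫⁻ x : Fin n → ℝ, ENNReal.ofReal (|v x| ^ (s - 1) * ‖WithLp.toLp 2 (T x)‖) ^ q := by
      rw [← lintegral_indicator (kcube_meas n L)]
      apply lintegral_congr
      intro x
      have hi : (kcube n L).indicator (fun x => ENNReal.ofReal (f x) *
          ENNReal.ofReal (‖WithLp.toLp 2 (T x)‖ ^ q)) x = ENNReal.ofReal (f x) *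
          ENNReal.ofReal (‖WithLp.toLp 2 (T x)‖ ^ q) := by
        by_cases h : x ∈ kcube n L
        · rw [Set.indicator_of_mem h]
        · rw [Set.indicator_of_notMem h, hfs x h]; simp
      rw [hi]
      · rw [ENNReal.ofReal_rpow_of_nonneg (by positivity) hqpos.le, ← ENNReal.ofReal_mul (hf0 x),
          Real.mul_rpow (by positivity) (by positivity), ← Real.rpow_mul (abs_nonneg _), hsq]
    rw [h2, h3] at h1
    have hm' : ENNReal.ofReal m ≠ 0 := by simpa using hmpos
    rw [show (c / m * ∫ y in kcube n R, g y * ‖WithLp.toLp 2 y‖ ^ q) =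
      (c * ∫ y in kcube n R, g y * ‖WithLp.toLp 2 y‖ ^ q) / m by ring,
      ENNReal.ofReal_div_of_pos hmpos, ENNReal.ofReal_mul hc0, ← h1, mul_comm,
      ENNReal.mul_div_cancel_right hm' ENNReal.ofReal_ne_top]
  rw [hW1, hV1] at hHol
  set J := ∫ y in kcube n R, g y * ‖WithLp.toLp 2 y‖ ^ q with hJdef
  set Wp := ∫ x : Fin n → ℝ, ‖gradient u (WithLp.toLp 2 x)‖ ^ p with hWp
  set I1 := ∫ y in kcube n R, g y ^ (1 - 1 / (n:ℝ)) with hI1def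
  set K := (m / c) ^ (-(1 / (n:ℝ))) / n with hK
  have hK0 : 0 ≤ K := by positivity
  have hs0 : 0 ≤ s := by linarith
  have hgnc : Continuous (fun y => g y ^ (-(1 / (n:ℝ)))) :=
    hgc.rpow_const fun y => Or.inl (hg y).ne'
  have hA := hpush (fun y => ENNReal.ofReal (g y ^ (-(1 / (n:ℝ))))) hgnc.measurable.ennreal_ofReal
  have hA1 : ∫⁻ y in kcube n R, ENNReal.ofReal (g y) * ENNReal.ofReal (g y ^ (-(1 / (n:ℝ)))) =
      ENNReal.ofReal I1 := by
    rw [hI1def, ← hcont_int (fun y => g y ^ (1 - 1 / (n:ℝ))) (hgc.rpow_const fun y => Or.inl (hg y).ne')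
      (fun y => Real.rpow_nonneg (hg y).le _)]
    apply lintegral_congr
    intro y
    rw [← ENNReal.ofReal_mul (hg y).le, sub_eq_add_neg, Real.rpow_add (hg y), Real.rpow_one]
  have hA2 : ∫⁻ x in kcube n L, ENNReal.ofReal (f x) *
      ENNReal.ofReal (g (T x) ^ (-(1 / (n:ℝ)))) ≤
      ENNReal.ofReal K * ∫⁻ x, ENNReal.ofReal (ψ x * ∑ k, d x k) := by
    rw [← lintegral_const_mul' _ _ ENNReal.ofReal_ne_top]
    refine (setLIntegral_le_lintegral _ _).trans (lintegral_mono fun x => ?_)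
    simp only
    rw [← ENNReal.ofReal_mul (hf0 x), ← ENNReal.ofReal_mul hK0]
    apply ENNReal.ofReal_le_ofReal
    exact kpoint n hn0 ps s |v x| (f x) (g (T x)) c m (d x) (hd0 x) (abs_nonneg _) hpsp
      (by linarith) hpss rfl (hg _) hcpos hmpos (hJ x)
  have hB2 : ∫⁻ x, ENNReal.ofReal (ψ x * ∑ k, d x k) ≤
      ENNReal.ofReal s * (ENNReal.ofReal (Wp ^ (1 / p)) *
        ENNReal.ofReal ((c / m * J) ^ (1 / q))) := by
    refine hB.trans ?_
    rw [lintegral_const_mul' _ _ ENNReal.ofReal_ne_top]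
    gcongr
    rw [ENNReal.ofReal_rpow_of_nonneg hW0 (by positivity),
      ENNReal.ofReal_rpow_of_nonneg (by positivity) (by positivity)] at hHol
    exact hHol
  rw [hA1] at hA
  have hfin : ENNReal.ofReal (c * I1) ≤
      ENNReal.ofReal (m * K * (s * (Wp ^ (1 / p) * (c / m * J) ^ (1 / q)))) := by
    rw [ENNReal.ofReal_mul hc0, ← hA]
    calc _ ≤ ENNReal.ofReal m * (ENNReal.ofReal K * (ENNReal.ofReal s *
          (ENNReal.ofReal (Wp ^ (1 / p)) * ENNReal.ofReal ((c / m * J) ^ (1 / q))))) := by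
          gcongr
          refine hA2.trans ?_
          gcongr
      _ = _ := by
          rw [ENNReal.ofReal_mul (by positivity), ENNReal.ofReal_mul hmpos.le,
            ENNReal.ofReal_mul hs0, ENNReal.ofReal_mul (by positivity)]
          ring
  rw [ENNReal.ofReal_le_ofReal_iff (by positivity)] at hfin
  exact kfinal_algebra n p q s c m I1 J (Wp ^ (1 / p)) (by positivity) hcpos hmpos hpq hJ0 hfin

theorem kgamma_lint (a r : ℝ) (ha : 0 < a) (hr : 0 < r) :
    ∫⁻ t in Set.Ioi (0:ℝ), ENNReal.ofReal (t ^ (a - 1) * Real.exp (-(r * t))) =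
      ENNReal.ofReal ((1 / r) ^ a * Real.Gamma a) := by
  have h1 := Real.integral_rpow_mul_exp_neg_mul_Ioi ha hr
  rw [← h1]
  have hG := Real.Gamma_pos_of_pos ha
  rw [ofReal_integral_eq_lintegral_ofReal]
  · apply Integrable.of_integral_ne_zero
    rw [h1]; positivity
  · filter_upwards [ae_restrict_mem measurableSet_Ioi] with t ht
    have : (0:ℝ) < t := ht
    simp only [Pi.zero_apply]
    positivity

theorem kbeta_lint (a b : ℝ) (ha : 0 < a) (hb : 0 < b) :
    ∫⁻ v in Set.Ioi (0:ℝ), ENNReal.ofReal (v ^ (a - 1) * (1 + v) ^ (-(a + b))) =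
      ENNReal.ofReal (Real.Gamma a * Real.Gamma b / Real.Gamma (a + b)) := by
  have hGa := Real.Gamma_pos_of_pos ha
  have hGb := Real.Gamma_pos_of_pos hb
  have hGab := Real.Gamma_pos_of_pos (add_pos ha hb)
  let F : ℝ → ℝ → ℝ := fun v t =>
    v ^ (a - 1) * (t ^ (a + b - 1) * Real.exp (-((1 + v) * t)))
  have hFm : Measurable (Function.uncurry F) := by
    unfold F Function.uncurry
    fun_prop
  have hswap : ∫⁻ v in Set.Ioi (0:ℝ), ∫⁻ t in Set.Ioi (0:ℝ), ENNReal.ofReal (F v t) =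
      ∫⁻ t in Set.Ioi (0:ℝ), ∫⁻ v in Set.Ioi (0:ℝ), ENNReal.ofReal (F v t) :=
    lintegral_lintegral_swap hFm.ennreal_ofReal.aemeasurable
  have hl : ∫⁻ v in Set.Ioi (0:ℝ), ∫⁻ t in Set.Ioi (0:ℝ), ENNReal.ofReal (F v t) =
      (∫⁻ v in Set.Ioi (0:ℝ), ENNReal.ofReal (v ^ (a - 1) * (1 + v) ^ (-(a + b)))) *
        ENNReal.ofReal (Real.Gamma (a + b)) := by
    rw [← lintegral_mul_const' _ _ ENNReal.ofReal_ne_top]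
    apply setLIntegral_congr_fun measurableSet_Ioi
    intro v hv
    have hv' : (0:ℝ) < v := hv
    simp only [F]
    simp_rw [ENNReal.ofReal_mul (by positivity : 0 ≤ v ^ (a - 1))]
    rw [lintegral_const_mul' _ _ ENNReal.ofReal_ne_top,
      kgamma_lint (a + b) (1 + v) (by linarith) (by linarith),
      Real.rpow_neg (by positivity),
      Real.div_rpow (by norm_num) (by positivity), Real.one_rpow, one_div,
      ENNReal.ofReal_mul (by positivity), mul_assoc]
  have hr : ∫⁻ t in Set.Ioi (0:ℝ), ∫⁻ v in Set.Ioi (0:ℝ), ENNReal.ofReal (F v t) =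
      ENNReal.ofReal (Real.Gamma a * Real.Gamma b) := by
    have h1 : ∀ t ∈ Set.Ioi (0:ℝ), ∫⁻ v in Set.Ioi (0:ℝ), ENNReal.ofReal (F v t) =
        ENNReal.ofReal (Real.Gamma a) *
          ENNReal.ofReal (t ^ (b - 1) * Real.exp (-(1 * t))) := by
      intro t ht
      have ht' : (0:ℝ) < t := ht
      have h2 : ∀ v, F v t = (t ^ (a + b - 1) * Real.exp (-t)) *
          (v ^ (a - 1) * Real.exp (-(t * v))) := by
        intro v
        simp only [F]
        rw [show -((1 + v) * t) = -t + -(t * v) by ring, Real.exp_add]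
        ring
      simp_rw [h2, ENNReal.ofReal_mul (by positivity : 0 ≤ t ^ (a + b - 1) * Real.exp (-t))]
      rw [lintegral_const_mul' _ _ ENNReal.ofReal_ne_top, kgamma_lint a t ha ht',
        ← ENNReal.ofReal_mul (by positivity), ← ENNReal.ofReal_mul (by positivity)]
      congr 1
      rw [Real.div_rpow (by norm_num) ht'.le, Real.one_rpow,
        show a + b - 1 = (b - 1) + a by ring, Real.rpow_add ht', one_mul]
      field_simp
    rw [setLIntegral_congr_fun measurableSet_Ioi h1,
      lintegral_const_mul' _ _ ENNReal.ofReal_ne_top, kgamma_lint b 1 hb one_pos,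
      ← ENNReal.ofReal_mul hGa.le]
    simp
  rw [hl, hr] at hswap
  rw [ENNReal.ofReal_div_of_pos hGab, ← hswap, ENNReal.mul_div_cancel_right _ ENNReal.ofReal_ne_top]
  simpa using hGab

theorem kbeta (a b : ℝ) (ha : 0 < a) (hb : 0 < b) :
    IntegrableOn (fun v : ℝ => v ^ (a - 1) * (1 + v) ^ (-(a + b))) (Set.Ioi 0) ∧
    ∫ v in Set.Ioi (0:ℝ), v ^ (a - 1) * (1 + v) ^ (-(a + b)) =
      Real.Gamma a * Real.Gamma b / Real.Gamma (a + b) := by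
  have hGa := Real.Gamma_pos_of_pos ha
  have hGb := Real.Gamma_pos_of_pos hb
  have hGab := Real.Gamma_pos_of_pos (add_pos ha hb)
  have h := kbeta_lint a b ha hb
  have hm : Measurable (fun v : ℝ => v ^ (a - 1) * (1 + v) ^ (-(a + b))) := by fun_prop
  have h0 : 0 ≤ᵐ[volume.restrict (Set.Ioi 0)]
      (fun v : ℝ => v ^ (a - 1) * (1 + v) ^ (-(a + b))) := by
    filter_upwards [ae_restrict_mem measurableSet_Ioi] with t ht
    have : (0:ℝ) < t := ht
    simp only [Pi.zero_apply]
    positivity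
  refine ⟨⟨hm.aestronglyMeasurable, ?_⟩, ?_⟩
  · rw [hasFiniteIntegral_iff_ofReal h0, h]
    exact ENNReal.ofReal_lt_top
  · rw [integral_eq_lintegral_of_nonneg_ae h0 hm.aestronglyMeasurable, h,
      ENNReal.toReal_ofReal (by positivity)]

theorem kradial (n : ℕ) (hn : 2 ≤ n) (q α β : ℝ) (hq : 0 < q) (hα : 0 ≤ α)
    (hβ : ((n:ℝ) + α) / q < β) :
    Integrable (fun x : EuclideanSpace ℝ (Fin n) => ‖x‖ ^ α * (1 + ‖x‖ ^ q) ^ (-β)) ∧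
    ∫ x : EuclideanSpace ℝ (Fin n), ‖x‖ ^ α * (1 + ‖x‖ ^ q) ^ (-β) =
      n * (Real.pi ^ ((n:ℝ) / 2) / Real.Gamma ((n:ℝ) / 2 + 1)) *
        (Real.Gamma (((n:ℝ) + α) / q) * Real.Gamma (β - ((n:ℝ) + α) / q) / Real.Gamma β / q) := by
  have hnr : (2:ℝ) ≤ n := by exact_mod_cast hn
  have : Nonempty (Fin n) := ⟨⟨0, by omega⟩⟩
  have hd : Module.finrank ℝ (EuclideanSpace ℝ (Fin n)) = n := by simp
  have : Nontrivial (EuclideanSpace ℝ (Fin n)) := by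
    apply Module.nontrivial_of_finrank_pos (R := ℝ)
    rw [hd]; omega
  have ha : 0 < ((n:ℝ) + α) / q := by positivity
  obtain ⟨hi, hv⟩ := kbeta (((n:ℝ) + α) / q) (β - ((n:ℝ) + α) / q) ha (by linarith)
  rw [show ((n:ℝ) + α) / q + (β - ((n:ℝ) + α) / q) = β by ring] at hi hv
  have hcong : ∀ y ∈ Set.Ioi (0:ℝ), y ^ (q - 1) • ((y ^ q) ^ (((n:ℝ) + α) / q - 1) *
      (1 + y ^ q) ^ (-β)) = y ^ (n - 1) • (y ^ α * (1 + y ^ q) ^ (-β)) := by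
    intro y hy
    have hy' : (0:ℝ) < y := hy
    simp only [smul_eq_mul]
    rw [← mul_assoc, ← mul_assoc, ← Real.rpow_mul hy'.le, ← Real.rpow_add hy',
      ← Real.rpow_natCast, ← Real.rpow_add hy', Nat.cast_sub (by omega)]
    congr 2
    field_simp
    push_cast
    ring
  constructor
  · rw [integrable_fun_norm_addHaar volume (f := fun r => r ^ α * (1 + r ^ q) ^ (-β)), hd]
    rw [← integrableOn_Ioi_comp_rpow_iff' _ hq.ne'] at hi
    exact hi.congr_fun hcong measurableSet_Ioi
  · rw [integral_fun_norm_addHaar volume (fun r => r ^ α * (1 + r ^ q) ^ (-β)), hd,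
      ← setIntegral_congr_fun measurableSet_Ioi hcong]
    have h2 := integral_comp_rpow_Ioi_of_pos (g := fun v : ℝ => v ^ (((n:ℝ) + α) / q - 1) *
      (1 + v) ^ (-β)) hq
    simp_rw [mul_smul] at h2
    rw [integral_smul, hv] at h2
    have h3 : (volume : Measure (EuclideanSpace ℝ (Fin n))).real (Metric.ball 0 1) =
        Real.pi ^ ((n:ℝ) / 2) / Real.Gamma ((n:ℝ) / 2 + 1) := by
      rw [Measure.real, EuclideanSpace.volume_ball]
      have : 0 < Real.Gamma ((n:ℝ) / 2 + 1) := Real.Gamma_pos_of_pos (by positivity)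
      simp only [Fintype.card_fin, ENNReal.ofReal_one, one_pow, one_mul]
      rw [ENNReal.toReal_ofReal (by positivity), Real.sqrt_eq_rpow, ← Real.rpow_natCast,
        ← Real.rpow_mul Real.pi_pos.le]
      congr 2
      ring
    rw [h3, ← h2]
    simp only [smul_eq_mul, nsmul_eq_mul]
    field_simp


theorem klim (n : ℕ) (φ : (Fin n → ℝ) → ℝ) (hφ : Integrable φ) :
    Filter.Tendsto (fun k : ℕ => ∫ y in kcube n ((k:ℝ) + 1), φ y) Filter.atTop
      (nhds (∫ y, φ y)) := by
  have hU : ⋃ k : ℕ, kcube n ((k:ℝ) + 1) = Set.univ := by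
    rw [Set.eq_univ_iff_forall]
    intro x
    obtain ⟨k, hk⟩ := exists_nat_ge ‖x‖
    rw [Set.mem_iUnion]
    refine ⟨k, ?_⟩
    have h2 : ∀ i, |x i| ≤ (k:ℝ) + 1 := fun i =>
      ((norm_le_pi_norm x i).trans hk).trans (by linarith)
    exact ⟨fun i => (abs_le.1 (h2 i)).1, fun i => (abs_le.1 (h2 i)).2⟩
  have h := tendsto_setIntegral_of_monotone (μ := volume) (f := φ)
    (s := fun k : ℕ => kcube n ((k:ℝ) + 1))
    (fun k => kcube_meas n _) (by
      intro k l hkl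
      have : (k:ℝ) ≤ l := by exact_mod_cast hkl
      exact Set.Icc_subset_Icc (fun _ => by simp only; linarith) (fun _ => by simp only; linarith))
    hφ.integrableOn
  rwa [hU, setIntegral_univ] at h

theorem kconst_algebra (n p q s κ I0 C W : ℝ) (hn : 0 < n) (hp : 0 < p) (hpn : p < n)
    (hq : 1 / p + 1 / q = 1) (hs : 0 < s) (hκ : 0 < κ) (hI0 : 0 < I0)
    (h : C * (s * I0) ≤ I0 ^ (1 / p - 1 / n) * (s / n * (κ * I0) ^ (1 / q) * W)) :
    C ≤ 1 / n * κ ^ (1 / q) * (1 / I0) ^ (1 / n) * W := by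
  have h1 : I0 ^ (1 / p - 1 / n) * I0 ^ (1 / q) = I0 * (1 / I0) ^ (1 / n) := by
    rw [← Real.rpow_add hI0, show 1 / p - 1 / n + 1 / q = 1 + -(1 / n) by linarith,
      Real.rpow_add hI0, Real.rpow_one, Real.rpow_neg hI0.le,
      Real.div_rpow zero_le_one hI0.le, Real.one_rpow, one_div (I0 ^ (1 / n))]
  rw [Real.mul_rpow hκ.le hI0.le] at h
  have h2 : I0 ^ (1 / p - 1 / n) * (s / n * (κ ^ (1 / q) * I0 ^ (1 / q)) * W) =
      (1 / n * κ ^ (1 / q) * (1 / I0) ^ (1 / n) * W) * (s * I0) := by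
    calc _ = (I0 ^ (1 / p - 1 / n) * I0 ^ (1 / q)) * (s / n * κ ^ (1 / q) * W) := by ring
      _ = _ := by rw [h1]; ring
  rw [h2] at h
  exact le_of_mul_le_mul_right h (by positivity)

/-- **Sharp Euclidean Sobolev inequality.** For `n ≥ 2`, `p ∈ (1,n)` and
`p* = pn/(n-p)`, every compactly supported `C¹` function `u : ℝⁿ → ℝ` satisfies
`(∫ |u|^{p*})^{1/p*} ≤ Eucl(n,p) (∫ |∇u|^p)^{1/p}`. -/
theorem sharp_euclidean_sobolev (n : ℕ) (hn : 2 ≤ n) (p : ℝ) (hp1 : 1 < p)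
    (hpn : p < (n : ℝ)) :
    ∀ u : EuclideanSpace ℝ (Fin n) → ℝ, ContDiff ℝ 1 u → HasCompactSupport u →
      (∫ x, |u x| ^ (p * n / ((n : ℝ) - p))) ^ (((n : ℝ) - p) / (p * n)) ≤
        Eucl n p * (∫ x, ‖gradient u x‖ ^ p) ^ (1 / p) := by
  intro u hu hus
  have hn0 : (2:ℝ) ≤ n := by exact_mod_cast hn
  have hnp : 0 < (n:ℝ) - p := by linarith
  have hp1' : 0 < p - 1 := by linarith
  have hp0 : 0 < p := by linarith
  set q := p / (p - 1) with hq
  have hq0 : 0 < q := by positivity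
  have hpq : 1 / p + 1 / q = 1 := by rw [hq]; field_simp; ring
  have hnq : (n:ℝ) / q = n - n / p := by
    rw [hq]; field_simp
  have hnp1 : 1 < (n:ℝ) / p := by rwa [lt_div_iff₀ hp0, one_mul]
  have hnq0 : 0 < (n:ℝ) / q := by positivity
  obtain ⟨hi0, hv0⟩ := kradial n hn q 0 n hq0 le_rfl (by rw [add_zero, hnq]; linarith)
  obtain ⟨hiJ, hvJ⟩ := kradial n hn q q n hq0 hq0.le (by
    rw [add_div, div_self hq0.ne', hnq]; linarith)
  simp only [Real.rpow_zero, one_mul, add_zero] at hi0 hv0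
  have hmp := PiLp.volume_preserving_toLp (Fin n)
  have hme : MeasurableEmbedding (WithLp.toLp 2 : (Fin n → ℝ) → EuclideanSpace ℝ (Fin n)) :=
    (MeasurableEquiv.toLp 2 (Fin n → ℝ)).measurableEmbedding
  have htr : ∀ φ : EuclideanSpace ℝ (Fin n) → ℝ,
      ∫ y : Fin n → ℝ, φ (WithLp.toLp 2 y) = ∫ x, φ x := fun φ => hmp.integral_comp hme φ
  set N : EuclideanSpace ℝ (Fin n) → ℝ := fun x => ‖x‖ with hN
  set g : EuclideanSpace ℝ (Fin n) → ℝ := fun x => (1 + ‖x‖ ^ q) ^ (-(n:ℝ)) with hg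
  have hbase : ∀ x : EuclideanSpace ℝ (Fin n), 0 < 1 + ‖x‖ ^ q := fun x => by positivity
  have hgpos : ∀ x, 0 < g x := fun x => Real.rpow_pos_of_pos (hbase x) _
  have hgc : Continuous g :=
    (continuous_const.add (continuous_norm.rpow_const fun x => Or.inr hq0.le)).rpow_const
      fun x => Or.inl (hbase x).ne'
  have hJeq : ∀ x : EuclideanSpace ℝ (Fin n),
      ‖x‖ ^ q * (1 + ‖x‖ ^ q) ^ (-(n:ℝ)) = g x * ‖x‖ ^ q := fun x => mul_comm _ _
  simp_rw [hJeq] at hiJ hvJ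
  have hg1 : ∀ x, g x ^ (1 - 1 / (n:ℝ)) = g x + g x * ‖x‖ ^ q := by
    intro x
    simp only [hg]
    rw [← Real.rpow_mul (hbase x).le,
      show -(n:ℝ) * (1 - 1 / n) = -n + 1 by field_simp; ring, Real.rpow_add (hbase x),
      Real.rpow_one]
    ring
  set I0 := ∫ x, g x with hI0
  set J := ∫ x, g x * ‖x‖ ^ q with hJ
  -- the values
  have hG1 : 0 < Real.Gamma ((n:ℝ) / q) := Real.Gamma_pos_of_pos hnq0
  have hG2 : 0 < Real.Gamma ((n:ℝ) / p) := Real.Gamma_pos_of_pos (by linarith)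
  have hG2' : 0 < Real.Gamma ((n:ℝ) / p - 1) := Real.Gamma_pos_of_pos (by linarith)
  have hG3 : 0 < Real.Gamma (n:ℝ) := Real.Gamma_pos_of_pos (by linarith)
  have hω : 0 < omegaN n := by
    unfold omegaN
    have : 0 < Real.Gamma ((n:ℝ) / 2 + 1) := Real.Gamma_pos_of_pos (by positivity)
    positivity
  change I0 = n * omegaN n * _ at hv0
  change J = n * omegaN n * _ at hvJ
  rw [show (n:ℝ) - n / q = n / p by rw [hnq]; ring] at hv0
  rw [add_div, div_self hq0.ne', Real.Gamma_add_one hnq0.ne',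
    show (n:ℝ) - (n / q + 1) = n / p - 1 by rw [hnq]; ring] at hvJ
  have hG4 : Real.Gamma ((n:ℝ) / p) = (n / p - 1) * Real.Gamma ((n:ℝ) / p - 1) := by
    have := Real.Gamma_add_one (s := (n:ℝ) / p - 1) (by linarith)
    rwa [sub_add_cancel] at this
  have hI0pos : 0 < I0 := by rw [hv0]; positivity
  set κ := (n:ℝ) * (p - 1) / (n - p) with hκ
  have hκ0 : 0 < κ := by positivity
  have hJv : J = κ * I0 := by
    rw [hvJ, hv0, hG4]
    have h1 : (n:ℝ) / q = κ * (n / p - 1) := by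
      rw [hq, hκ]; field_simp
    rw [h1]
    ring
  have hI0v : 1 / I0 = Real.Gamma ((n:ℝ) + 1) /
      (n * omegaN n * Real.Gamma ((n:ℝ) / p) * Real.Gamma ((n:ℝ) + 1 - n / p)) := by
    rw [show (n:ℝ) + 1 - n / p = n / q + 1 by rw [hnq]; ring, Real.Gamma_add_one hnq0.ne',
      Real.Gamma_add_one (by linarith : (n:ℝ) ≠ 0), hv0]
    field_simp
  have hI1v : ∫ x, g x ^ (1 - 1 / (n:ℝ)) = p * (n - 1) / (n - p) * I0 := by
    simp_rw [hg1]
    rw [integral_add hi0 hiJ, ← hI0, ← hJ, hJv, hκ]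
    field_simp
    ring
  have hi1 : Integrable (fun x => g x ^ (1 - 1 / (n:ℝ))) := by
    simp_rw [hg1]
    exact hi0.add hiJ
  -- passage to the limit
  have hIt : ∀ φ : EuclideanSpace ℝ (Fin n) → ℝ, Integrable φ →
      Filter.Tendsto (fun k : ℕ => ∫ y in kcube n ((k:ℝ) + 1), φ (WithLp.toLp 2 y)) Filter.atTop
      (nhds (∫ x, φ x)) := by
    intro φ hφ
    rw [← htr φ]
    exact klim n _ ((hmp.integrable_comp_emb hme).2 hφ)
  have hT0 := hIt _ hi0
  have hT1 := hIt _ hi1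
  have hTJ := hIt _ hiJ
  have hmain := fun k : ℕ => kmain n hn p hp1 hpn u hu hus (fun y => g (WithLp.toLp 2 y))
    (hgc.comp (PiLp.continuous_toLp 2 _)) (fun y => hgpos _) ((k:ℝ) + 1) (by positivity)
  rw [htr (fun x => |u x| ^ (p * n / ((n : ℝ) - p))), htr (fun x => ‖gradient u x‖ ^ p)] at hmain
  have hlim := le_of_tendsto_of_tendsto' (hT1.const_mul _)
    ((hT0.rpow_const (p := 1 / p - 1 / (n:ℝ)) (Or.inl hI0pos.ne')).mul
      (((hTJ.rpow_const (p := 1 / q) (Or.inr (by positivity))).const_mul _).mul_const _)) hmain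
  rw [hI1v, ← hI0, ← hJ, hJv] at hlim
  have hfin := kconst_algebra n p q _ κ I0 _ _ (by linarith) hp0 hpn hpq
    (div_pos (mul_pos hp0 (by linarith)) hnp) hκ0 hI0pos hlim
  rw [hI0v, show 1 / q = (p - 1) / p by rw [hq, one_div_div],
    show 1 / p - 1 / (n:ℝ) = ((n:ℝ) - p) / (p * n) by field_simp] at hfin
  exact hfin
end
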